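/- arXiv:1704.05745 — 3 statements merged into one kernel-verified Lean document; each statement's English description precedes it below -/
import Mathlib

section
/- Let X be a complete separable metric space, ν a σ-finite Borel measure on X, c < ∞, and (μ_k) a sequence of random finite Borel measures on X on a probability space (Ω, 𝒜, P) such that: (i) for each k there is a jointly measurable function g_k : X × Ω → [0,∞) with, for P-almost every ω, μ_{k,ω}(E) = ∫_E g_k(x, ω) dν(x) for every Borel set E, and ∫_Ω g_k(x, ω) dP(ω) ≤ c for every x ∈ X and every k; (ii) for every compact set A ⊆ X, the sequence of random variables μ_k(A) converges in probability to some random variable. Then for every Borel measurable f : X → ℝ with ∫ |f| dν < ∞, the sequence ∫ f dμ_k converges in probability to a random variable Y satisfying E(|Y|) ≤ c · ∫ |f| dν. -/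
open MeasureTheory Filter Set Topology

section ConvergenceInMeasure

open scoped ENNReal

variable {α ι E : Type*} {m : MeasurableSpace α} {μ : Measure α} [NormedAddCommGroup E]

theorem measure_le_enorm_add_le (u v : α → E) (ε : ℝ≥0∞) :
    μ {x | ε ≤ ‖u x + v x‖ₑ} ≤ μ {x | ε / 2 ≤ ‖u x‖ₑ} + μ {x | ε / 2 ≤ ‖v x‖ₑ} := by
  refine (measure_mono fun x hx => ?_).trans (measure_union_le _ _)
  by_contra h
  simp only [mem_union, mem_ofPred_eq, not_or, not_le] at h hx
  have := (enorm_add_le (u x) (v x)).trans_lt (ENNReal.add_lt_add h.1 h.2)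
  rw [ENNReal.add_halves] at this
  exact absurd hx this.not_ge

protected theorem MeasureTheory.TendstoInMeasure.add {l : Filter ι} {u v : ι → α → E} {a b : α → E}
    (hu : TendstoInMeasure μ u l a) (hv : TendstoInMeasure μ v l b) :
    TendstoInMeasure μ (fun i x => u i x + v i x) l (fun x => a x + b x) := by
  rw [tendstoInMeasure_iff_enorm] at *
  intro ε hε hε'
  have hε2 : ε / 2 ≠ ∞ := ENNReal.div_ne_top hε' two_ne_zero
  have h := (hu (ε / 2) (ENNReal.half_pos hε.ne') hε2).add
    (hv (ε / 2) (ENNReal.half_pos hε.ne') hε2)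
  rw [add_zero] at h
  refine tendsto_of_tendsto_of_tendsto_of_le_of_le tendsto_const_nhds h (fun _ => zero_le)
    fun i => ?_
  simp_rw [add_sub_add_comm]
  exact measure_le_enorm_add_le _ _ _

protected theorem MeasureTheory.TendstoInMeasure.neg {l : Filter ι} {u : ι → α → E} {a : α → E}
    (hu : TendstoInMeasure μ u l a) :
    TendstoInMeasure μ (fun i x => -u i x) l (fun x => -a x) := by
  rw [tendstoInMeasure_iff_enorm] at *
  intro ε hε hε'
  simpa only [← neg_sub', enorm_neg] using hu ε hε hε'

protected theorem MeasureTheory.TendstoInMeasure.sub {l : Filter ι} {u v : ι → α → E} {a b : α → E}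
    (hu : TendstoInMeasure μ u l a) (hv : TendstoInMeasure μ v l b) :
    TendstoInMeasure μ (fun i x => u i x - v i x) l (fun x => a x - b x) := by
  simpa only [sub_eq_add_neg] using hu.add hv.neg

protected theorem MeasureTheory.TendstoInMeasure.const_mul {l : Filter ι} {u : ι → α → ℝ} {a : α → ℝ}
    (r : ℝ) (hu : TendstoInMeasure μ u l a) :
    TendstoInMeasure μ (fun i x => r * u i x) l (fun x => r * a x) := by
  rw [tendstoInMeasure_iff_norm] at *
  intro ε hε
  rcases eq_or_ne r 0 with rfl | hr
  · simpa [hε.not_ge] using tendsto_const_nhds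
  · have hr' : 0 < |r| := abs_pos.2 hr
    refine (hu (ε / |r|) (by positivity)).congr fun i => ?_
    simp_rw [← mul_sub, norm_mul, Real.norm_eq_abs r, div_le_iff₀' hr']

/-- Convergence in measure follows from approximation in `L¹`, uniformly along the sequence, by
sequences converging in measure to limits that approximate the candidate limit. -/
theorem tendstoInMeasure_of_eLpNorm_approx {l : Filter ι} {u : ι → α → E} {a : α → E}
    (h : ∀ ε : ℝ≥0∞, 0 < ε → ∃ (v : ι → α → E) (b : α → E), TendstoInMeasure μ v l b ∧
      AEStronglyMeasurable (b - a) μ ∧ eLpNorm (b - a) 1 μ ≤ ε ∧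
      ∀ i, AEStronglyMeasurable (u i - v i) μ ∧ eLpNorm (u i - v i) 1 μ ≤ ε) :
    TendstoInMeasure μ u l a := by
  rw [tendstoInMeasure_iff_enorm]
  intro ε hε hε'
  have hε2 : 0 < ε / 2 := ENNReal.half_pos hε.ne'
  have hε2' : ε / 2 ≠ ∞ := ENNReal.div_ne_top hε' two_ne_zero
  rw [ENNReal.tendsto_nhds_zero]
  intro δ hδ
  have hδ2 : 0 < δ / 2 := ENNReal.half_pos hδ.ne'
  obtain ⟨v, b, hv, hbm, hb, huv⟩ := h ((ε / 2 * (δ / 2)) / 2)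
    (ENNReal.half_pos (ENNReal.mul_pos hε2.ne' hδ2.ne').ne')
  filter_upwards [ENNReal.tendsto_nhds_zero.1
    (tendstoInMeasure_iff_enorm.1 hv (ε / 2) hε2 hε2') (δ / 2) hδ2] with i hi
  have hsplit : ∀ x, u i x - a x = ((u i - v i) + (b - a)) x + (v i x - b x) := fun x => by
    simp only [Pi.add_apply, Pi.sub_apply]; abel
  have hnorm : eLpNorm ((u i - v i) + (b - a)) 1 μ ≤ ε / 2 * (δ / 2) :=
    (eLpNorm_add_le (huv i).1 hbm le_rfl).trans
      ((add_le_add (huv i).2 hb).trans_eq (ENNReal.add_halves _))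
  rw [eLpNorm_one_eq_lintegral_enorm] at hnorm
  have hmarkov := (mul_meas_ge_le_lintegral₀ ((huv i).1.add hbm).enorm (ε / 2)).trans hnorm
  rw [ENNReal.mul_le_mul_iff_right hε2.ne' hε2'] at hmarkov
  simp_rw [hsplit]
  exact (measure_le_enorm_add_le _ _ _).trans
    ((add_le_add hmarkov hi).trans_eq (ENNReal.add_halves _))

/-- The sequences converging in measure to an `L¹` limit are closed under approximation in `L¹`,
uniformly along the sequence. -/
theorem exists_tendstoInMeasure_of_eLpNorm_approx {F : Type*} [NormedAddCommGroup F]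
    [CompleteSpace F] {u : ℕ → α → F} (hu : ∀ k, AEStronglyMeasurable (u k) μ)
    (h : ∀ ε : ℝ≥0∞, 0 < ε → ∃ (v : ℕ → α → F) (b : α → F), MemLp b 1 μ ∧
      TendstoInMeasure μ v atTop b ∧
      ∀ k, AEStronglyMeasurable (v k) μ ∧ eLpNorm (u k - v k) 1 μ ≤ ε) :
    ∃ a, MemLp a 1 μ ∧ TendstoInMeasure μ u atTop a := by
  have hpos : ∀ n : ℕ, (0 : ℝ≥0∞) < 2⁻¹ ^ n := fun n => ENNReal.pow_pos (by simp) n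
  choose v b hb hvb hv huv using fun n : ℕ => h (2⁻¹ ^ n) (hpos n)
  have hcauchy : ∀ N n m : ℕ, N ≤ n → N ≤ m →
      eLpNorm (b n - b m) 1 μ < 3 * 2⁻¹ ^ N := by
    intro N n m hn hm
    have hpow : ∀ j, N ≤ j → (2⁻¹ : ℝ≥0∞) ^ j ≤ 2⁻¹ ^ N := fun j hj =>
      pow_le_pow_right_of_le_one' (by simp) hj
    have hle : eLpNorm (b n - b m) 1 μ ≤ 2 * 2⁻¹ ^ N := by
      refine eLpNorm_le_of_tendstoInMeasure (.of_forall fun k => ?_) ((hvb n).sub (hvb m))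
        fun k => (hv n k).sub (hv m k)
      have hsplit : (fun x => v n k x - v m k x) = (u k - v m k) - (u k - v n k) := by
        ext x; simp
      rw [hsplit, two_mul]
      exact (eLpNorm_sub_le ((hu k).sub (hv m k)) ((hu k).sub (hv n k)) le_rfl).trans
        (add_le_add ((huv m k).trans (hpow m hm)) ((huv n k).trans (hpow n hn)))
    refine hle.trans_lt ?_
    rw [ENNReal.mul_lt_mul_iff_left (hpos N).ne' (ENNReal.pow_ne_top (by simp))]
    norm_num
  obtain ⟨a, ha, hlim⟩ := Lp.cauchy_complete_eLpNorm le_rfl hb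
    (by simp [ENNReal.tsum_mul_left, ENNReal.tsum_geometric, ENNReal.mul_eq_top]) hcauchy
  refine ⟨a, ha, tendstoInMeasure_of_eLpNorm_approx fun ε hε => ?_⟩
  obtain ⟨n, hn, hn'⟩ := ((ENNReal.tendsto_nhds_zero.1 hlim ε hε).and
    (ENNReal.tendsto_nhds_zero.1
      (ENNReal.tendsto_pow_atTop_nhds_zero_of_lt_one (r := 2⁻¹) (by simp)) ε hε)).exists
  exact ⟨v n, b n, hvb n, (hb n).1.sub ha.1, hn, fun k =>
    ⟨(hu k).sub (hv n k), (huv n k).trans hn'⟩⟩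

end ConvergenceInMeasure

section RandomDensity

open scoped ENNReal NNReal

variable {X Ω : Type*} [MeasurableSpace X] [MeasurableSpace Ω] {P : Measure Ω} {ν : Measure X}
  [SFinite P] {c : ℝ≥0} {g : X → Ω → ℝ≥0} {f h : X → ℝ}

theorem lintegral_enorm_density_mul_le (hg : Measurable fun p : X × Ω => g p.1 p.2)
    (hexp : ∀ x, ∫⁻ ω, (g x ω : ℝ≥0∞) ∂P ≤ c) (hf : AEStronglyMeasurable f ν) :
    ∫⁻ p, ‖(g p.1 p.2 : ℝ) * f p.1‖ₑ ∂(ν.prod P) ≤ c * ∫⁻ x, ‖f x‖ₑ ∂ν := by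
  have hgf : AEStronglyMeasurable (fun p : X × Ω => (g p.1 p.2 : ℝ) * f p.1) (ν.prod P) :=
    hg.coe_nnreal_real.aestronglyMeasurable.mul hf.comp_fst
  rw [lintegral_prod _ hgf.enorm, ← lintegral_const_mul'' _ hf.enorm]
  refine lintegral_mono fun x => ?_
  have hgx : Measurable fun ω => (g x ω : ℝ≥0∞) :=
    (hg.comp measurable_prodMk_left).coe_nnreal_ennreal
  have : ∀ ω, ‖(g x ω : ℝ) * f x‖ₑ = (g x ω : ℝ≥0∞) * ‖f x‖ₑ := fun ω => by
    rw [enorm_mul]; congr 1; simp [enorm_eq_nnnorm]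
  simp_rw [this]
  rw [lintegral_mul_const _ hgx]
  gcongr
  exact hexp x

theorem integrable_density_mul (hg : Measurable fun p : X × Ω => g p.1 p.2)
    (hexp : ∀ x, ∫⁻ ω, (g x ω : ℝ≥0∞) ∂P ≤ c) (hf : Integrable f ν) :
    Integrable (fun p : X × Ω => (g p.1 p.2 : ℝ) * f p.1) (ν.prod P) :=
  ⟨hg.coe_nnreal_real.aestronglyMeasurable.mul hf.1.comp_fst,
    (lintegral_enorm_density_mul_le hg hexp hf.1).trans_lt
      (ENNReal.mul_lt_top ENNReal.coe_lt_top hf.2)⟩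

variable [SFinite ν]

theorem eLpNorm_integral_density_mul_le (hg : Measurable fun p : X × Ω => g p.1 p.2)
    (hexp : ∀ x, ∫⁻ ω, (g x ω : ℝ≥0∞) ∂P ≤ c) (hf : AEStronglyMeasurable f ν) :
    eLpNorm (fun ω => ∫ x, (g x ω : ℝ) * f x ∂ν) 1 P ≤ c * eLpNorm f 1 ν := by
  have hgf : AEStronglyMeasurable (fun p : X × Ω => (g p.1 p.2 : ℝ) * f p.1) (ν.prod P) :=
    hg.coe_nnreal_real.aestronglyMeasurable.mul hf.comp_fst
  rw [eLpNorm_one_eq_lintegral_enorm, eLpNorm_one_eq_lintegral_enorm]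
  refine (lintegral_mono fun ω => enorm_integral_le_lintegral_enorm _).trans ?_
  rw [← lintegral_prod_symm _ hgf.enorm]
  exact lintegral_enorm_density_mul_le hg hexp hf

theorem integral_density_mul_add (hg : Measurable fun p : X × Ω => g p.1 p.2)
    (hexp : ∀ x, ∫⁻ ω, (g x ω : ℝ≥0∞) ∂P ≤ c) (hf : Integrable f ν) (hh : Integrable h ν) :
    (fun ω => ∫ x, (g x ω : ℝ) * (f + h) x ∂ν) =ᵐ[P]
      fun ω => (∫ x, (g x ω : ℝ) * f x ∂ν) + ∫ x, (g x ω : ℝ) * h x ∂ν := by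
  filter_upwards [(integrable_density_mul hg hexp hf).prod_left_ae,
    (integrable_density_mul hg hexp hh).prod_left_ae] with ω hfω hhω
  rw [← integral_add hfω hhω]
  simp [mul_add]

theorem integral_density_mul_sub (hg : Measurable fun p : X × Ω => g p.1 p.2)
    (hexp : ∀ x, ∫⁻ ω, (g x ω : ℝ≥0∞) ∂P ≤ c) (hf : Integrable f ν) (hh : Integrable h ν) :
    (fun ω => ∫ x, (g x ω : ℝ) * (f - h) x ∂ν) =ᵐ[P]
      (fun ω => ∫ x, (g x ω : ℝ) * f x ∂ν) - fun ω => ∫ x, (g x ω : ℝ) * h x ∂ν := by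
  filter_upwards [(integrable_density_mul hg hexp hf).prod_left_ae,
    (integrable_density_mul hg hexp hh).prod_left_ae] with ω hfω hhω
  rw [Pi.sub_apply, ← integral_sub hfω hhω]
  simp [mul_sub]

end RandomDensity

section DensitySequence

open scoped ENNReal NNReal

variable {X Ω : Type*} [MeasurableSpace X] [MeasurableSpace Ω] {P : Measure Ω} {ν : Measure X}
  [SFinite ν] [SFinite P] {c : ℝ≥0} {g : ℕ → X → Ω → ℝ≥0} {f : X → ℝ}

theorem exists_tendstoInMeasure_integral_density_of_approx
    (hg : ∀ k, Measurable fun p : X × Ω => g k p.1 p.2)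
    (hexp : ∀ k x, ∫⁻ ω, (g k x ω : ℝ≥0∞) ∂P ≤ c) (hf : Integrable f ν)
    (happrox : ∀ ε : ℝ≥0∞, 0 < ε → ∃ h : X → ℝ, Integrable h ν ∧ eLpNorm (f - h) 1 ν ≤ ε ∧
      ∃ Z, MemLp Z 1 P ∧
        TendstoInMeasure P (fun k ω => ∫ x, (g k x ω : ℝ) * h x ∂ν) atTop Z) :
    ∃ Z, MemLp Z 1 P ∧
      TendstoInMeasure P (fun k ω => ∫ x, (g k x ω : ℝ) * f x ∂ν) atTop Z := by
  refine exists_tendstoInMeasure_of_eLpNorm_approx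
    (fun k => (integrable_density_mul (hg k) (hexp k) hf).integral_prod_right.1) fun ε hε => ?_
  obtain ⟨h, hh, hfh, Z, hZ, hlim⟩ := happrox (ε / c)
    (ENNReal.div_pos hε.ne' ENNReal.coe_ne_top)
  refine ⟨_, Z, hZ, hlim, fun k =>
    ⟨(integrable_density_mul (hg k) (hexp k) hh).integral_prod_right.1, ?_⟩⟩
  rw [← eLpNorm_congr_ae (integral_density_mul_sub (hg k) (hexp k) hf hh)]
  refine (eLpNorm_integral_density_mul_le (hg k) (hexp k) (hf.1.sub hh.1)).trans ?_
  exact (mul_le_mul_right hfh _).trans ENNReal.mul_div_le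

/-- If the integrals of the random densities over compact sets of finite measure converge in
measure, so do their integrals against any integrable function. -/
theorem exists_tendstoInMeasure_integral_density [TopologicalSpace X] [T2Space X] [BorelSpace X]
    [ν.InnerRegularCompactLTTop]
    (hg : ∀ k, Measurable fun p : X × Ω => g k p.1 p.2)
    (hexp : ∀ k x, ∫⁻ ω, (g k x ω : ℝ≥0∞) ∂P ≤ c)
    (hconv : ∀ A : Set X, IsCompact A → ν A < ∞ →
      ∃ Z, TendstoInMeasure P (fun k ω => ∫ x in A, (g k x ω : ℝ) ∂ν) atTop Z)
    (hf : Integrable f ν) :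
    ∃ Z, MemLp Z 1 P ∧
      TendstoInMeasure P (fun k ω => ∫ x, (g k x ω : ℝ) * f x ∂ν) atTop Z := by
  refine Integrable.induction (fun f : X → ℝ => ∃ Z, MemLp Z 1 P ∧
    TendstoInMeasure P (fun k ω => ∫ x, (g k x ω : ℝ) * f x ∂ν) atTop Z) ?_ ?_ ?_ ?_ hf
  · intro r s hs hνs
    have hr : ∀ t, MeasurableSet t → ν t < ∞ → Integrable (t.indicator fun _ => r) ν :=
      fun t ht hνt => (integrable_indicator_iff ht).2 (integrableOn_const hνt.ne)
    refine exists_tendstoInMeasure_integral_density_of_approx hg hexp (hr s hs hνs)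
      fun ε hε => ?_
    obtain ⟨K, hKs, hK, hνK⟩ := hs.exists_isCompact_sdiff_lt hνs.ne
      (ENNReal.div_pos hε.ne' (enorm_ne_top (x := r))).ne'
    have hνK' : ν K < ∞ := (measure_mono hKs).trans_lt hνs
    have hKint := hr K hK.measurableSet hνK'
    refine ⟨K.indicator fun _ => r, hKint, ?_, ?_⟩
    · rw [← indicator_sdiff hKs, eLpNorm_indicator_const (hs.diff hK.measurableSet) one_ne_zero
        ENNReal.one_ne_top]
      simp only [ENNReal.toReal_one, div_one, ENNReal.rpow_one]
      exact (mul_le_mul_right hνK.le _).trans ENNReal.mul_div_le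
    · obtain ⟨Z, hZ⟩ := hconv K hK hνK'
      have hlim : TendstoInMeasure P
          (fun k ω => ∫ x, (g k x ω : ℝ) * K.indicator (fun _ => r) x ∂ν) atTop
          (fun ω => r * Z ω) := by
        convert hZ.const_mul r using 3 with k ω
        rw [← integral_const_mul, ← integral_indicator hK.measurableSet]
        congr 1 with x
        by_cases hx : x ∈ K <;> simp [hx, mul_comm]
      have hint := fun k => (integrable_density_mul (hg k) (hexp k) hKint).integral_prod_right
      refine ⟨_, ⟨hlim.aestronglyMeasurable fun k => (hint k).1, ?_⟩, hlim⟩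
      refine (eLpNorm_le_of_tendstoInMeasure (.of_forall fun k =>
        eLpNorm_integral_density_mul_le (hg k) (hexp k) hKint.1) hlim
        fun k => (hint k).1).trans_lt ?_
      exact ENNReal.mul_lt_top ENNReal.coe_lt_top (memLp_one_iff_integrable.2 hKint).2
  · intro f h _ hf hh hfZ hhZ
    obtain ⟨Y, hY, hfY⟩ := hfZ
    obtain ⟨Z, hZ, hhZ⟩ := hhZ
    exact ⟨_, hY.add hZ, (hfY.add hhZ).congr_left fun k =>
      (integral_density_mul_add (hg k) (hexp k) hf hh).symm⟩
  · refine isClosed_of_closure_subset fun f hf => ?_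
    refine exists_tendstoInMeasure_integral_density_of_approx hg hexp (L1.integrable_coeFn f)
      fun ε hε => ?_
    obtain ⟨h, hh, hfh⟩ := EMetric.mem_closure_iff.1 hf ε hε
    exact ⟨h, L1.integrable_coeFn h, (Lp.edist_def f h ▸ hfh).le, hh⟩
  · intro f h hfh _ hfZ
    obtain ⟨Z, hZ, hlim⟩ := hfZ
    refine ⟨Z, hZ, ?_⟩
    convert hlim using 3 with k ω
    exact integral_congr_ae (by filter_upwards [hfh] with x hx; rw [hx])

end DensitySequence

/-- **Convergence in probability of integrals against random measures with uniformly
expectation-bounded densities.**  If the random finite measures `μ_k` have densities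
`g k` with respect to `ν` satisfying `E(g k x) ≤ c` for all `x`, and `μ_k(A)` converges
in probability for every compact `A`, then for every Borel `f` with `∫|f| dν < ∞` the
integrals `∫ f dμ_k` converge in probability to a random variable `Y` with
`E(|Y|) ≤ c·∫|f| dν`. -/
theorem integral_tendstoInMeasure_of_density_bound
    {X : Type*} [MetricSpace X] [CompleteSpace X] [TopologicalSpace.SeparableSpace X]
    [MeasurableSpace X] [BorelSpace X]
    {Ω : Type*} [MeasurableSpace Ω] (P : Measure Ω) [IsProbabilityMeasure P]
    (ν : Measure X) [SigmaFinite ν]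
    (c : NNReal)
    (μs : ℕ → Ω → Measure X)
    (hfin : ∀ k ω, IsFiniteMeasure (μs k ω))
    (hmeas : ∀ (k : ℕ) (E : Set X), MeasurableSet E → Measurable fun ω => μs k ω E)
    (g : ℕ → X → Ω → NNReal)
    (hgmeas : ∀ k, Measurable fun p : X × Ω => g k p.1 p.2)
    (hdens : ∀ k, ∀ᵐ ω ∂P, ∀ E : Set X, MeasurableSet E →
      μs k ω E = ∫⁻ x in E, (g k x ω : ENNReal) ∂ν)
    (hexp : ∀ (k : ℕ) (x : X), ∫⁻ ω, (g k x ω : ENNReal) ∂P ≤ (c : ENNReal))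
    (hconv : ∀ A : Set X, IsCompact A →
      ∃ Z : Ω → ℝ, TendstoInMeasure P (fun k ω => (μs k ω A).toReal) atTop Z)
    (f : X → ℝ) (hfmeas : Measurable f) (hfint : Integrable f ν) :
    ∃ Y : Ω → ℝ,
      TendstoInMeasure P (fun k ω => ∫ x, f x ∂(μs k ω)) atTop Y ∧
      ∫⁻ ω, (‖Y ω‖₊ : ENNReal) ∂P ≤ (c : ENNReal) * ∫⁻ x, (‖f x‖₊ : ENNReal) ∂ν := by
  have hrepr : ∀ (k : ℕ) (h : X → ℝ),
      (fun ω => ∫ x, h x ∂(μs k ω)) =ᵐ[P] fun ω => ∫ x, (g k x ω : ℝ) * h x ∂ν := by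
    intro k h
    filter_upwards [hdens k] with ω hω
    have hμ : μs k ω = ν.withDensity fun x => (g k x ω : ENNReal) :=
      Measure.ext fun E hE => by rw [hω E hE, withDensity_apply _ hE]
    rw [hμ, integral_withDensity_eq_integral_smul
      (f := fun x => g k x ω) ((hgmeas k).comp measurable_prodMk_right)]
    rfl
  have hcompact : ∀ A : Set X, IsCompact A → ν A < ⊤ →
      ∃ Z, TendstoInMeasure P (fun k ω => ∫ x in A, (g k x ω : ℝ) ∂ν) atTop Z := by
    intro A hA _
    obtain ⟨Z, hZ⟩ := hconv A hA
    refine ⟨Z, hZ.congr_left fun k => ?_⟩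
    filter_upwards [hrepr k (A.indicator 1)] with ω hω
    rw [integral_indicator_one hA.measurableSet] at hω
    rw [← measureReal_def, hω, ← integral_indicator hA.measurableSet]
    congr 1 with x
    by_cases hx : x ∈ A <;> simp [hx]
  have : SecondCountableTopology X := UniformSpace.secondCountable_of_separable X
  obtain ⟨Y, -, hY⟩ := exists_tendstoInMeasure_integral_density hgmeas hexp hcompact hfint
  refine ⟨Y, hY.congr_left fun k => (hrepr k f).symm, ?_⟩
  have hbound := eLpNorm_le_of_tendstoInMeasure (.of_forall fun k =>
    eLpNorm_integral_density_mul_le (hgmeas k) (hexp k) hfint.1) hY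
    fun k => (integrable_density_mul (hgmeas k) (hexp k) hfint).integral_prod_right.1
  simp only [eLpNorm_one_eq_lintegral_enorm] at hbound
  exact hbound
end

section
/- Let X be a complete separable metric space, ν a finite Borel measure on X, c < ∞, and (μ_k) a sequence of random finite Borel measures on X on a probability space (Ω, 𝒜, P) such that: (i) for each k there is a jointly measurable function g_k : X × Ω → [0,∞) with, for P-almost every ω, μ_{k,ω}(E) = ∫_E g_k(x, ω) dν(x) for every Borel set E, and ∫_Ω g_k(x, ω) dP(ω) ≤ c for every x ∈ X and every k; (ii) for every compact set A ⊆ X, the sequence μ_k(A) converges in probability to some random variable. Then there exists a random finite Borel measure μ on X such that μ_k weakly converges to μ subsequentially in probability; moreover, for every Borel measurable f : X → ℝ with ∫ |f| dν < ∞, the sequence ∫ f dμ_k converges in probability to ∫ f dμ, and E( |∫ f dμ| ) ≤ c · ∫ |f| dν. -/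
open MeasureTheory Filter Set Topology

/-- A sequence of random Borel measures `μs` *weakly converges to `μ` subsequentially in
probability*: every subsequence has a further subsequence along which, on a single event
of full probability, the measures converge weakly (integrals of every bounded continuous
function converge). -/
def WeakSubseqInProb {X : Type*} [TopologicalSpace X] [MeasurableSpace X]
    {Ω : Type*} [MeasurableSpace Ω] (P : Measure Ω)
    (μs : ℕ → Ω → Measure X) (μ : Ω → Measure X) : Prop :=
  ∀ α : ℕ → ℕ, StrictMono α →
    ∃ β : ℕ → ℕ, StrictMono β ∧ Set.range β ⊆ Set.range α ∧
      ∃ H : Set Ω, MeasurableSet H ∧ P H = 1 ∧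
        ∀ ω ∈ H, ∀ f : BoundedContinuousFunction X ℝ,
          Tendsto (fun k => ∫ x, f x ∂(μs (β k) ω)) atTop (𝓝 (∫ x, f x ∂(μ ω)))

open ProbabilityTheory
open scoped ENNReal

section Portmanteau

variable {X : Type*} [TopologicalSpace X] [MeasurableSpace X] [OpensMeasurableSpace X]
  {μ : Measure X} [IsFiniteMeasure μ] {μs : ℕ → Measure X} [∀ i, IsFiniteMeasure (μs i)]

lemma eventually_lt_integral_of_nonneg_of_forall_isOpen_le_liminf
    (h_opens : ∀ G, IsOpen G → μ G ≤ atTop.liminf (fun i ↦ μs i G))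
    (f : BoundedContinuousFunction X ℝ) (hf : 0 ≤ ⇑f) {v : ℝ} (hv : v < ∫ x, f x ∂μ) :
    ∀ᶠ i in atTop, v < ∫ x, f x ∂(μs i) := by
  rcases lt_or_ge v 0 with h0 | h0
  · exact .of_forall fun i ↦ h0.trans_le (integral_nonneg hf)
  have hlim := lintegral_le_liminf_lintegral_of_forall_isOpen_measure_le_liminf_measure
    f.continuous hf h_opens
  rw [← ofReal_integral_eq_lintegral_ofReal (f.integrable μ) (.of_forall hf)] at hlim
  have hlt := ((ENNReal.ofReal_lt_ofReal_iff_of_nonneg h0).2 hv).trans_le hlim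
  filter_upwards [eventually_lt_of_lt_liminf hlt] with i hi
  rw [← ofReal_integral_eq_lintegral_ofReal (f.integrable (μs i)) (.of_forall hf)] at hi
  exact (ENNReal.ofReal_lt_ofReal_iff_of_nonneg h0).1 hi

lemma eventually_lt_integral_of_forall_isOpen_le_liminf
    (h_opens : ∀ G, IsOpen G → μ G ≤ atTop.liminf (fun i ↦ μs i G))
    (h_univ : Tendsto (fun i ↦ (μs i).real univ) atTop (𝓝 (μ.real univ)))
    (f : BoundedContinuousFunction X ℝ) {v : ℝ} (hv : v < ∫ x, f x ∂μ) :
    ∀ᶠ i in atTop, v < ∫ x, f x ∂(μs i) := by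
  have hint : ∀ (ρ : Measure X) [IsFiniteMeasure ρ],
      ∫ x, (f + BoundedContinuousFunction.const X ‖f‖) x ∂ρ
        = ∫ x, f x ∂ρ + ρ.real univ * ‖f‖ := fun ρ _ ↦ by
    simp [integral_add (f.integrable ρ) (integrable_const ‖f‖)]
  have hnn : 0 ≤ ⇑(f + BoundedContinuousFunction.const X ‖f‖) := fun x ↦ by
    have := neg_le_of_abs_le (f.norm_coe_le_norm x)
    simp only [Pi.zero_apply, BoundedContinuousFunction.coe_add, Pi.add_apply,
      BoundedContinuousFunction.const_apply]
    linarith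
  obtain ⟨w, hvw, hw⟩ := exists_between hv
  have h1 := eventually_lt_integral_of_nonneg_of_forall_isOpen_le_liminf h_opens _ hnn
    (v := w + μ.real univ * ‖f‖) (by rw [hint μ]; linarith)
  have h2 := (h_univ.mul_const ‖f‖).eventually_lt_const
    (show μ.real univ * ‖f‖ < μ.real univ * ‖f‖ + (w - v) by linarith)
  filter_upwards [h1, h2] with i hi hi'
  rw [hint (μs i)] at hi
  linarith

lemma tendsto_integral_of_forall_isOpen_le_liminf
    (h_opens : ∀ G, IsOpen G → μ G ≤ atTop.liminf (fun i ↦ μs i G))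
    (h_univ : Tendsto (fun i ↦ (μs i).real univ) atTop (𝓝 (μ.real univ)))
    (f : BoundedContinuousFunction X ℝ) :
    Tendsto (fun i ↦ ∫ x, f x ∂(μs i)) atTop (𝓝 (∫ x, f x ∂μ)) := by
  refine tendsto_order.2 ⟨fun v hv ↦
    eventually_lt_integral_of_forall_isOpen_le_liminf h_opens h_univ f hv, fun v hv ↦ ?_⟩
  have h := eventually_lt_integral_of_forall_isOpen_le_liminf h_opens h_univ (-f) (v := -v)
    (by simpa [integral_neg] using hv)
  filter_upwards [h] with i hi
  simpa [integral_neg] using hi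

/-- Weak convergence of finite measures follows from convergence on the total mass and on the
finite unions of the members of a countable family `B` of open sets forming a basis. -/
lemma tendsto_integral_of_tendsto_finite_sUnion {B : Set (Set X)} (hB : B.Countable)
    (hbasis : TopologicalSpace.IsTopologicalBasis B)
    (h_union : ∀ s ⊆ B, s.Finite → Tendsto (fun i ↦ (μs i).real (⋃₀ s)) atTop (𝓝 (μ.real (⋃₀ s))))
    (h_univ : Tendsto (fun i ↦ (μs i).real univ) atTop (𝓝 (μ.real univ)))
    (f : BoundedContinuousFunction X ℝ) :
    Tendsto (fun i ↦ ∫ x, f x ∂(μs i)) atTop (𝓝 (∫ x, f x ∂μ)) := by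
  refine tendsto_integral_of_forall_isOpen_le_liminf (fun G hG ↦ ?_) h_univ f
  obtain ⟨S, hSB, rfl⟩ := hbasis.open_eq_sUnion hG
  have hS : S.Countable := hB.mono hSB
  rcases S.eq_empty_or_nonempty with rfl | hne
  · simp
  obtain ⟨u, rfl⟩ := hS.exists_eq_range hne
  rw [sUnion_range, measure_iUnion_eq_iSup_accumulate]
  refine iSup_le fun n ↦ ?_
  have hacc : accumulate u n = ⋃₀ (u '' Iic n) := by
    ext x; simp [mem_accumulate]
  have hlim := h_union (u '' Iic n) ((image_subset_range _ _).trans hSB)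
    ((finite_Iic n).image u)
  rw [← hacc] at hlim
  have hlim' : Tendsto (fun i ↦ μs i (accumulate u n)) atTop (𝓝 (μ (accumulate u n))) := by
    simpa [Measure.real, ENNReal.ofReal_toReal, measure_ne_top] using ENNReal.tendsto_ofReal hlim
  rw [← hlim'.liminf_eq]
  exact liminf_le_liminf (.of_forall fun i ↦ measure_mono (accumulate_subset_iUnion n))

end Portmanteau

section InMeasure

variable {Ω : Type*} [MeasurableSpace Ω] {P : Measure Ω}

lemma exists_seq_forall_nat_tendsto_ae {E : Type*} [PseudoEMetricSpace E]
    {F : ℕ → ℕ → Ω → E} {G : ℕ → Ω → E} (h : ∀ n, TendstoInMeasure P (F n) atTop (G n)) :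
    ∃ ns : ℕ → ℕ, StrictMono ns ∧
      ∀ᵐ ω ∂P, ∀ n, Tendsto (fun k ↦ F n (ns k) ω) atTop (𝓝 (G n ω)) := by
  have hpow : ∀ k : ℕ, (0 : ℝ≥0∞) < 2⁻¹ ^ k := fun k ↦ ENNReal.pow_pos (by simp) k
  have hsel : ∀ k : ℕ, ∀ᶠ j in atTop, ∀ n ∈ Iic k,
      P {ω | (2⁻¹ : ℝ≥0∞) ^ k ≤ edist (F n j ω) (G n ω)} < 2⁻¹ ^ k := fun k ↦
    (eventually_all_finite (finite_Iic k)).2 fun n _ ↦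
      (h n _ (hpow k)).eventually_lt_const (hpow k)
  obtain ⟨ns, hmono, hns⟩ := extraction_forall_of_eventually hsel
  refine ⟨ns, hmono, ae_all_iff.2 fun n ↦ ?_⟩
  have hsum : ∑' k, P {ω | (2⁻¹ : ℝ≥0∞) ^ (k + n) ≤ edist (F n (ns (k + n)) ω) (G n ω)} ≠ ∞ := by
    refine ne_top_of_le_ne_top (b := ∑' k : ℕ, (2⁻¹ : ℝ≥0∞) ^ k) (by simp) ?_
    refine ENNReal.tsum_le_tsum fun k ↦ (hns (k + n) n (by simp)).le.trans ?_
    exact pow_le_pow_of_le_one (by simp) (by simp) (Nat.le_add_right k n)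
  filter_upwards [ae_eventually_notMem hsum] with ω hω
  rw [← tendsto_add_atTop_iff_nat n, tendsto_iff_edist_tendsto_0]
  have hz : Tendsto (fun k : ℕ ↦ (2⁻¹ : ℝ≥0∞) ^ (k + n)) atTop (𝓝 0) :=
    (tendsto_add_atTop_iff_nat n).2 (ENNReal.tendsto_pow_atTop_nhds_zero_of_lt_one (by simp))
  refine tendsto_of_tendsto_of_tendsto_of_le_of_le' tendsto_const_nhds hz (by simp) ?_
  filter_upwards [hω] with k hk
  simpa using (not_le.1 hk).le

/-- Countably many sequences converging in measure have a common subsequence along which they all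
converge almost everywhere. -/
lemma exists_seq_forall_tendsto_ae {ι E : Type*} [Countable ι] [PseudoEMetricSpace E]
    {F : ι → ℕ → Ω → E} {G : ι → Ω → E} (h : ∀ i, TendstoInMeasure P (F i) atTop (G i)) :
    ∃ ns : ℕ → ℕ, StrictMono ns ∧
      ∀ᵐ ω ∂P, ∀ i, Tendsto (fun k ↦ F i (ns k) ω) atTop (𝓝 (G i ω)) := by
  cases isEmpty_or_nonempty ι
  · exact ⟨id, strictMono_id, .of_forall fun _ i ↦ isEmptyElim i⟩
  obtain ⟨u, hu⟩ := exists_surjective_nat ι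
  obtain ⟨ns, hmono, hns⟩ := exists_seq_forall_nat_tendsto_ae fun n ↦ h (u n)
  exact ⟨ns, hmono, hns.mono fun ω hω ↦ hu.forall.2 hω⟩

/-- Convergence in measure is stable under approximation in `L¹`, uniform along the sequence. -/
lemma tendstoInMeasure_of_forall_lintegral_edist_le {f : ℕ → Ω → ℝ} {g : Ω → ℝ}
    (hf : ∀ k, Measurable (f k)) (hg : Measurable g)
    (h : ∀ δ : ℝ≥0∞, 0 < δ → ∃ (f' : ℕ → Ω → ℝ) (g' : Ω → ℝ),
      (∀ k, Measurable (f' k)) ∧ Measurable g' ∧ TendstoInMeasure P f' atTop g' ∧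
      (∀ k, ∫⁻ ω, edist (f k ω) (f' k ω) ∂P ≤ δ) ∧ ∫⁻ ω, edist (g ω) (g' ω) ∂P ≤ δ) :
    TendstoInMeasure P f atTop g := by
  refine tendstoInMeasure_of_ne_top fun ε hε hε' ↦ ENNReal.tendsto_nhds_zero.2 fun η hη ↦ ?_
  have h3 : ε / 3 ≠ 0 := by simp [hε.ne']
  have h3' : ε / 3 ≠ ∞ := ENNReal.div_ne_top hε' (by simp)
  have hη3 : 0 < η / 3 := ENNReal.div_pos hη.ne' (by simp)
  obtain ⟨f', g', hf', hg', hlim, hk, hgk⟩ := h (ε / 3 * (η / 3))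
    (ENNReal.mul_pos h3 hη3.ne')
  have markov : ∀ {a b : Ω → ℝ}, Measurable a → Measurable b →
      ∫⁻ ω, edist (a ω) (b ω) ∂P ≤ ε / 3 * (η / 3) →
      P {ω | ε / 3 ≤ edist (a ω) (b ω)} ≤ η / 3 := fun ha hb hab ↦ by
    have := (mul_meas_ge_le_lintegral (ha.edist hb) (ε / 3)).trans hab
    exact (ENNReal.mul_le_mul_iff_right h3 h3').1 this
  filter_upwards [(hlim _ (pos_iff_ne_zero.2 h3)).eventually_le_const hη3] with k hlk
  have hsub : {ω | ε ≤ edist (f k ω) (g ω)} ⊆ {ω | ε / 3 ≤ edist (f k ω) (f' k ω)} ∪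
      {ω | ε / 3 ≤ edist (f' k ω) (g' ω)} ∪ {ω | ε / 3 ≤ edist (g ω) (g' ω)} := fun ω hω ↦ by
    by_contra hcon
    simp only [mem_union, mem_ofPred_eq, not_or, not_le] at hcon hω
    have htri := edist_triangle4 (f k ω) (f' k ω) (g' ω) (g ω)
    rw [edist_comm (g' ω)] at htri
    have hlt := ENNReal.add_lt_add (ENNReal.add_lt_add hcon.1.1 hcon.1.2) hcon.2
    rw [ENNReal.add_thirds] at hlt
    exact absurd (hω.trans htri) (not_le.2 hlt)
  calc P {ω | ε ≤ edist (f k ω) (g ω)}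
      ≤ _ := measure_mono hsub
    _ ≤ _ := (measure_union_le _ _).trans (add_le_add_left (measure_union_le _ _) _)
    _ ≤ η / 3 + η / 3 + η / 3 := by
        gcongr
        · exact markov (hf k) (hf' k) (hk k)
        · exact markov hg hg' hgk
    _ = η := ENNReal.add_thirds η

end InMeasure

section RandomContent

/-- A family of random variables indexed by the measurable sets which is almost surely finitely
additive, the exceptional event depending on the sets, and whose mean is dominated by `ρ`. -/
structure IsRandomContent {X Ω : Type*} [MeasurableSpace X] [MeasurableSpace Ω] (P : Measure Ω)
    (ρ : Measure X) (ζ : Set X → Ω → ℝ≥0∞) : Prop where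
  measurable : ∀ E, MeasurableSet E → Measurable (ζ E)
  union : ∀ A B, MeasurableSet A → MeasurableSet B → Disjoint A B →
    ∀ᵐ ω ∂P, ζ (A ∪ B) ω = ζ A ω + ζ B ω
  lintegral_le : ∀ E, MeasurableSet E → ∫⁻ ω, ζ E ω ∂P ≤ ρ E

namespace IsRandomContent

variable {X Ω : Type*} [MeasurableSpace X] [MeasurableSpace Ω] {P : Measure Ω}
  {ρ : Measure X} {ζ : Set X → Ω → ℝ≥0∞}

lemma map {Y : Type*} [MeasurableSpace Y] (h : IsRandomContent P ρ ζ) {e : X → Y}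
    (he : Measurable e) : IsRandomContent P (ρ.map e) (fun B ↦ ζ (e ⁻¹' B)) where
  measurable E hE := h.measurable _ (he hE)
  union A B hA hB hAB := h.union _ _ (he hA) (he hB) (hAB.preimage e)
  lintegral_le E hE := by
    rw [Measure.map_apply he hE]
    exact h.lintegral_le _ (he hE)

lemma ae_eq_zero (h : IsRandomContent P ρ ζ) {E : Set X} (hE : MeasurableSet E) (h0 : ρ E = 0) :
    ∀ᵐ ω ∂P, ζ E ω = 0 :=
  (lintegral_eq_zero_iff (h.measurable E hE)).1 (nonpos_iff_eq_zero.1 (h0 ▸ h.lintegral_le E hE))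

lemma ae_add_diff (h : IsRandomContent P ρ ζ) {A B : Set X} (hA : MeasurableSet A)
    (hB : MeasurableSet B) (hAB : A ⊆ B) : ∀ᵐ ω ∂P, ζ B ω = ζ A ω + ζ (B \ A) ω := by
  have := h.union A (B \ A) hA (hB.diff hA) disjoint_sdiff_right
  rwa [union_sdiff_cancel hAB] at this

lemma ae_mono (h : IsRandomContent P ρ ζ) {A B : Set X} (hA : MeasurableSet A)
    (hB : MeasurableSet B) (hAB : A ⊆ B) : ∀ᵐ ω ∂P, ζ A ω ≤ ζ B ω := by
  filter_upwards [h.ae_add_diff hA hB hAB] with ω hω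
  exact hω ▸ le_self_add

lemma ae_finset_biUnion (h : IsRandomContent P ρ ζ) {A : ℕ → Set X}
    (hA : ∀ n, MeasurableSet (A n)) (hdisj : Pairwise (Function.onFun Disjoint A)) (n : ℕ) :
    ∀ᵐ ω ∂P, ζ (⋃ i ∈ Finset.range n, A i) ω = ∑ i ∈ Finset.range n, ζ (A i) ω := by
  induction n with
  | zero => simpa using h.ae_eq_zero MeasurableSet.empty measure_empty
  | succ n ih =>
    have hd : Disjoint (⋃ i ∈ Finset.range n, A i) (A n) := by
      simp only [disjoint_iUnion_left, Finset.mem_range]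
      exact fun i hi ↦ hdisj hi.ne
    filter_upwards [ih, h.union _ _ (Finset.measurableSet_biUnion _ fun i _ ↦ hA i) (hA n) hd]
      with ω h1 h2
    rw [Finset.sum_range_succ, ← h1, ← h2, Finset.range_add_one, Finset.set_biUnion_insert,
      union_comm]

variable [IsFiniteMeasure ρ]

lemma ae_ne_top (h : IsRandomContent P ρ ζ) {E : Set X} (hE : MeasurableSet E) :
    ∀ᵐ ω ∂P, ζ E ω ≠ ∞ := by
  filter_upwards [ae_lt_top (h.measurable E hE)
    (ne_top_of_le_ne_top (measure_ne_top ρ E) (h.lintegral_le E hE))] with ω hω using hω.ne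

lemma ae_tendsto_zero (h : IsRandomContent P ρ ζ) {B : ℕ → Set X}
    (hB : ∀ n, MeasurableSet (B n)) (hanti : Antitone B) (hinter : ⋂ n, B n = ∅) :
    ∀ᵐ ω ∂P, Tendsto (fun n ↦ ζ (B n) ω) atTop (𝓝 0) := by
  have hlim : Tendsto (fun n ↦ ρ (B n)) atTop (𝓝 0) := by
    have := tendsto_measure_iInter_atTop (μ := ρ) (fun n ↦ (hB n).nullMeasurableSet) hanti
      ⟨0, measure_ne_top _ _⟩
    rwa [hinter, measure_empty] at this
  have hzero : ∫⁻ ω, ⨅ n, ζ (B n) ω ∂P = 0 := by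
    refine le_antisymm (ge_of_tendsto' hlim fun n ↦ ?_) zero_le
    exact (lintegral_mono fun ω ↦ iInf_le _ n).trans (h.lintegral_le _ (hB n))
  have hmono : ∀ᵐ ω ∂P, ∀ n, ζ (B (n + 1)) ω ≤ ζ (B n) ω :=
    ae_all_iff.2 fun n ↦ h.ae_mono (hB _) (hB _) (hanti n.le_succ)
  filter_upwards [hmono,
    (lintegral_eq_zero_iff (Measurable.iInf fun n ↦ h.measurable _ (hB n))).1 hzero] with ω h1 h2
  rw [← (show ⨅ n, ζ (B n) ω = 0 from h2)]
  exact tendsto_atTop_iInf (antitone_nat_of_succ_le h1)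

lemma ae_iUnion (h : IsRandomContent P ρ ζ) {A : ℕ → Set X}
    (hA : ∀ n, MeasurableSet (A n)) (hdisj : Pairwise (Function.onFun Disjoint A)) :
    ∀ᵐ ω ∂P, ζ (⋃ i, A i) ω = ∑' i, ζ (A i) ω := by
  have hS : ∀ n, MeasurableSet (⋃ i ∈ Finset.range n, A i) := fun n ↦
    Finset.measurableSet_biUnion _ fun i _ ↦ hA i
  have hU : MeasurableSet (⋃ i, A i) := .iUnion hA
  have hmono : Monotone fun n ↦ ⋃ i ∈ Finset.range n, A i := fun m n hmn ↦
    biUnion_subset_biUnion_left fun i hi ↦ by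
      simp only [Finset.mem_range, Finset.mem_coe] at hi ⊢; omega
  have hrest := h.ae_tendsto_zero (B := fun n ↦ (⋃ i, A i) \ ⋃ i ∈ Finset.range n, A i)
    (fun n ↦ hU.diff (hS n)) (fun m n hmn ↦ sdiff_subset_sdiff_right (hmono hmn)) (by
      ext x
      simp only [mem_iInter, Set.mem_sdiff, Finset.mem_range, mem_empty_iff_false,
        iff_false]
      intro hx
      obtain ⟨i, hi⟩ := mem_iUnion.1 (hx 0).1
      exact (hx (i + 1)).2 (mem_iUnion₂.2 ⟨i, i.lt_succ_self, hi⟩))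
  filter_upwards [hrest, ae_all_iff.2 (h.ae_finset_biUnion hA hdisj),
    ae_all_iff.2 fun n ↦ h.ae_add_diff (hS n) hU (iUnion₂_subset_iUnion _ _)] with ω h1 h2 h3
  have hsum := (ENNReal.summable (f := fun i ↦ ζ (A i) ω)).hasSum.tendsto_sum_nat.add h1
  refine tendsto_nhds_unique (tendsto_const_nhds.congr fun n ↦ ?_) (by rwa [add_zero] at hsum)
  rw [h3 n, h2 n]

lemma isRatStieltjesPoint {ρ : Measure ℝ} [IsFiniteMeasure ρ] {ζ : Set ℝ → Ω → ℝ≥0∞}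
    (h : IsRandomContent P ρ ζ) :
    ∀ᵐ ω ∂P, ζ univ ω ≠ 0 →
      IsRatStieltjesPoint (fun ω (q : ℚ) ↦ (ζ (Iic (q : ℝ)) ω / ζ univ ω).toReal) ω := by
  have hbot := h.ae_tendsto_zero (B := fun n : ℕ ↦ Iic (((-n : ℚ)) : ℝ))
    (fun _ ↦ measurableSet_Iic) (fun m n hmn ↦ Iic_subset_Iic.2 (by simpa using hmn)) (by
      refine eq_empty_of_forall_notMem fun x hx ↦ ?_
      obtain ⟨n, hn⟩ := exists_nat_gt (-x)
      have := mem_iInter.1 hx n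
      simp only [mem_Iic, Rat.cast_neg, Rat.cast_natCast] at this
      linarith)
  have htop := h.ae_tendsto_zero (B := fun n : ℕ ↦ univ \ Iic (((n : ℚ)) : ℝ))
    (fun _ ↦ .diff .univ measurableSet_Iic)
    (fun m n hmn ↦ sdiff_subset_sdiff_right (Iic_subset_Iic.2 (by simpa using hmn))) (by
      refine eq_empty_of_forall_notMem fun x hx ↦ ?_
      obtain ⟨n, hn⟩ := exists_nat_gt x
      have := mem_iInter.1 hx n
      simp only [Set.mem_sdiff, mem_univ, true_and, mem_Iic, Rat.cast_natCast, not_le] at this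
      linarith)
  have hright := ae_all_iff.2 fun t : ℚ ↦
    h.ae_tendsto_zero (B := fun n : ℕ ↦ Iic ((t + 1 / (n + 1) : ℚ) : ℝ) \ Iic (t : ℝ))
    (fun _ ↦ .diff measurableSet_Iic measurableSet_Iic)
    (fun m n hmn ↦ sdiff_subset_sdiff_left (Iic_subset_Iic.2 (by
      have : (1 : ℝ) / (n + 1) ≤ 1 / (m + 1) := Nat.one_div_le_one_div hmn
      push_cast
      linarith))) (by
      refine eq_empty_of_forall_notMem fun x hx ↦ ?_
      have h0 := mem_iInter.1 hx 0
      simp only [Set.mem_sdiff, mem_Iic, not_le] at h0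
      obtain ⟨n, hn⟩ := exists_nat_one_div_lt (sub_pos.2 h0.2)
      have := mem_iInter.1 hx n
      simp only [Set.mem_sdiff, mem_Iic, not_le] at this
      push_cast at this
      linarith)
  have hadd_univ := ae_all_iff.2 fun q : ℚ ↦
    h.ae_add_diff (A := Iic (q : ℝ)) measurableSet_Iic .univ (subset_univ _)
  have hadd := ae_all_iff.2 fun p : ℚ × ℚ ↦ ae_all_iff.2 fun hpq : p.1 ≤ p.2 ↦
    h.ae_add_diff (A := Iic (p.1 : ℝ)) (B := Iic (p.2 : ℝ)) measurableSet_Iic measurableSet_Iic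
      (Iic_subset_Iic.2 (by exact_mod_cast hpq))
  filter_upwards [hbot, htop, hright, hadd_univ, hadd, h.ae_ne_top .univ]
    with ω hbot htop hright hadd_univ hadd hfin h0
  have hle : ∀ q : ℚ, ζ (Iic (q : ℝ)) ω ≤ ζ univ ω := fun q ↦ hadd_univ q ▸ le_self_add
  have hq_fin : ∀ q : ℚ, ζ (Iic (q : ℝ)) ω / ζ univ ω ≠ ∞ := fun q ↦
    ENNReal.div_ne_top (ne_top_of_le_ne_top hfin (hle q)) h0
  have hmono : Monotone fun q : ℚ ↦ (ζ (Iic (q : ℝ)) ω / ζ univ ω).toReal := fun q r hqr ↦ by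
    refine ENNReal.toReal_mono (hq_fin r) (ENNReal.div_le_div_right ?_ _)
    exact hadd (q, r) hqr ▸ le_self_add
  have hlim : ∀ {u : ℕ → ℚ} {a : ℝ≥0∞},
      Tendsto (fun n ↦ ζ (Iic (u n : ℝ)) ω) atTop (𝓝 a) → a ≠ ∞ →
      Tendsto (fun n ↦ (ζ (Iic (u n : ℝ)) ω / ζ univ ω).toReal) atTop
        (𝓝 (a / ζ univ ω).toReal) := fun hu ha ↦
    (ENNReal.tendsto_toReal (ENNReal.div_ne_top ha h0)).comp
      (ENNReal.Tendsto.div_const hu (.inr h0))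
  refine ⟨hmono, ?_, ?_, fun t ↦ ?_⟩
  · have hu : Tendsto (fun n : ℕ ↦ ζ (Iic (((n : ℚ)) : ℝ)) ω) atTop (𝓝 (ζ univ ω)) := by
      have := ENNReal.Tendsto.sub (tendsto_const_nhds (x := ζ univ ω) (f := atTop)) htop (.inl hfin)
      rw [tsub_zero] at this
      refine this.congr fun n ↦ ?_
      refine ENNReal.sub_eq_of_eq_add ?_ (hadd_univ n)
      exact ne_top_of_le_ne_top hfin (hadd_univ n ▸ le_add_self)
    have := hlim hu hfin
    rw [ENNReal.div_self h0 hfin, ENNReal.toReal_one] at this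
    exact (tendsto_iff_tendsto_subseq_of_monotone hmono tendsto_natCast_atTop_atTop).2 this
  · have := hlim hbot ENNReal.zero_ne_top
    rw [ENNReal.zero_div, ENNReal.toReal_zero] at this
    refine tendsto_order.2 ⟨fun a ha ↦ .of_forall fun q ↦ ha.trans_le ENNReal.toReal_nonneg,
      fun a ha ↦ ?_⟩
    obtain ⟨n, hn⟩ := (this.eventually_lt_const ha).exists
    filter_upwards [eventually_le_atBot (-n : ℚ)] with q hq using (hmono hq).trans_lt hn
  · have hu : Tendsto (fun n : ℕ ↦ ζ (Iic ((t + 1 / (n + 1) : ℚ) : ℝ)) ω) atTop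
        (𝓝 (ζ (Iic (t : ℝ)) ω)) := by
      have := (hright t).const_add (ζ (Iic (t : ℝ)) ω)
      rw [add_zero] at this
      refine this.congr fun n ↦ (hadd (t, t + 1 / (n + 1)) ?_).symm
      simp only [le_add_iff_nonneg_right]
      positivity
    have hbdd : BddBelow (range fun r : Ioi t ↦ (ζ (Iic ((r : ℚ) : ℝ)) ω / ζ univ ω).toReal) :=
      ⟨0, by rintro _ ⟨r, rfl⟩; exact ENNReal.toReal_nonneg⟩
    refine le_antisymm ?_ (le_ciInf fun r ↦ hmono r.2.le)
    refine ge_of_tendsto' (hlim hu (ne_top_of_le_ne_top hfin (hle t))) fun n ↦ ?_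
    refine ciInf_le hbdd (⟨t + 1 / (n + 1), ?_⟩ : Ioi t)
    simp only [mem_Ioi, lt_add_iff_pos_right]
    positivity

lemma exists_measure_real {ρ : Measure ℝ} [IsFiniteMeasure ρ] {ζ : Set ℝ → Ω → ℝ≥0∞}
    (h : IsRandomContent P ρ ζ) :
    ∃ μ : Ω → Measure ℝ, (∀ ω, IsFiniteMeasure (μ ω)) ∧ Measurable μ ∧
      ∀ B, MeasurableSet B → ∀ᵐ ω ∂P, μ ω B = ζ B ω := by
  set f : Ω → ℚ → ℝ := fun ω q ↦ (ζ (Iic (q : ℝ)) ω / ζ univ ω).toReal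
  have hf : Measurable f := measurable_pi_lambda _ fun q ↦
    ((h.measurable _ measurableSet_Iic).div (h.measurable _ .univ)).ennreal_toReal
  refine ⟨fun ω ↦ (ζ univ ω).toNNReal • (stieltjesOfMeasurableRat f hf ω).measure,
    fun ω ↦ inferInstance, ?_, ?_⟩
  · refine Measure.measurable_of_measurable_coe _ fun s hs ↦ ?_
    simp only [Measure.smul_apply, ENNReal.smul_def, smul_eq_mul]
    exact (h.measurable _ .univ).ennreal_toNNReal.coe_nnreal_ennreal.mul
      ((Measure.measurable_coe hs).comp (measurable_measure_stieltjesOfMeasurableRat hf))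
  simp only [Measure.smul_apply, ENNReal.smul_def, smul_eq_mul]
  have huniv : ∀ᵐ ω ∂P, ((ζ univ ω).toNNReal : ℝ≥0∞) = ζ univ ω := by
    filter_upwards [h.ae_ne_top .univ] with ω hω using ENNReal.coe_toNNReal hω
  intro B hB
  induction B, hB using MeasurableSpace.induction_on_inter
    (BorelSpace.measurable_eq.trans Real.borel_eq_generateFrom_Iic_rat) Real.isPiSystem_Iic_rat with
  | empty =>
    filter_upwards [h.ae_eq_zero MeasurableSet.empty measure_empty] with ω hω
    simp [hω]
  | basic t ht =>
    obtain ⟨q, rfl⟩ := by simpa using ht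
    filter_upwards [h.isRatStieltjesPoint, huniv, h.ae_ne_top .univ,
      h.ae_mono (A := Iic (q : ℝ)) measurableSet_Iic .univ (subset_univ _)] with ω h1 h2 h3 h4
    rw [h2]
    rcases eq_or_ne (ζ univ ω) 0 with h0 | h0
    · rw [h0, zero_mul, eq_comm]
      exact nonpos_iff_eq_zero.1 (h0 ▸ h4)
    · rw [measure_stieltjesOfMeasurableRat_Iic, stieltjesOfMeasurableRat_eq,
        toRatCDF_of_isRatStieltjesPoint (h1 h0), ENNReal.ofReal_toReal
        (ENNReal.div_ne_top (ne_top_of_le_ne_top h3 h4) h0), ENNReal.mul_div_cancel h0 h3]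
  | compl t ht ih =>
    filter_upwards [ih, huniv, h.ae_ne_top .univ, h.ae_add_diff ht .univ (subset_univ t)]
      with ω h1 h2 h3 h4
    rw [← compl_eq_univ_sdiff] at h4
    have h5 : ζ t ω ≠ ∞ := ne_top_of_le_ne_top h3 (h4 ▸ le_self_add)
    rw [← ENNReal.add_right_inj h5, ← h4, ← h1, ← mul_add, measure_add_measure_compl ht,
      measure_univ, mul_one, h2]
  | iUnion A hdisj hA ih =>
    filter_upwards [ae_all_iff.2 ih, h.ae_iUnion hA hdisj] with ω h1 h2
    rw [measure_iUnion hdisj hA, h2, ← ENNReal.tsum_mul_left]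
    exact tsum_congr h1

/-- A random content on a standard Borel space has a version which is a random measure. -/
theorem exists_measure [StandardBorelSpace X] (h : IsRandomContent P ρ ζ) :
    ∃ μ : Ω → Measure X, (∀ ω, IsFiniteMeasure (μ ω)) ∧ Measurable μ ∧
      ∀ E, MeasurableSet E → ∀ᵐ ω ∂P, μ ω E = ζ E ω := by
  obtain ⟨e, he⟩ := exists_measurableEmbedding_real X
  obtain ⟨μ, hfin, hmeas, hμ⟩ := (h.map he.measurable).exists_measure_real
  refine ⟨fun ω ↦ (μ ω).comap e, fun ω ↦ ⟨?_⟩, ?_, fun E hE ↦ ?_⟩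
  · rw [he.comap_apply]
    exact measure_lt_top _ _
  · refine Measure.measurable_of_measurable_coe _ fun s hs ↦ ?_
    simp only [he.comap_apply]
    exact (Measure.measurable_coe (he.measurableSet_image.2 hs)).comp hmeas
  · filter_upwards [hμ (e '' E) (he.measurableSet_image.2 hE)] with ω hω
    rw [he.comap_apply, hω, preimage_image_eq _ he.injective]

end IsRandomContent

end RandomContent

section RandomMeasure

variable {X Ω : Type*} [MeasurableSpace X] [MeasurableSpace Ω] {P : Measure Ω} {ρ : Measure X}

lemma lintegral_lintegral_le_of_mean_le {κ : Ω → Measure X} (hκ : Measurable κ)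
    (hle : ∀ E, MeasurableSet E → ∫⁻ ω, κ ω E ∂P ≤ ρ E) {h : X → ℝ≥0∞} (hh : Measurable h) :
    ∫⁻ ω, ∫⁻ x, h x ∂(κ ω) ∂P ≤ ∫⁻ x, h x ∂ρ := by
  rw [← Measure.lintegral_bind hκ.aemeasurable hh.aemeasurable]
  refine lintegral_mono' (Measure.le_iff.2 fun E hE ↦ ?_) le_rfl
  rw [Measure.bind_apply hE hκ.aemeasurable]
  exact hle E hE

lemma lintegral_enorm_integral_le_of_mean_le {κ : Ω → Measure X} (hκ : Measurable κ)
    (hle : ∀ E, MeasurableSet E → ∫⁻ ω, κ ω E ∂P ≤ ρ E) {f : X → ℝ} (hf : Measurable f) :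
    ∫⁻ ω, ‖∫ x, f x ∂(κ ω)‖ₑ ∂P ≤ ∫⁻ x, ‖f x‖ₑ ∂ρ :=
  (lintegral_mono fun _ ↦ enorm_integral_le_lintegral_enorm f).trans
    (lintegral_lintegral_le_of_mean_le hκ hle hf.enorm)

lemma ae_integrable_of_mean_le {κ : Ω → Measure X} (hκ : Measurable κ)
    (hle : ∀ E, MeasurableSet E → ∫⁻ ω, κ ω E ∂P ≤ ρ E) {f : X → ℝ} (hf : Measurable f)
    (hint : Integrable f ρ) : ∀ᵐ ω ∂P, Integrable f (κ ω) := by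
  filter_upwards [ae_lt_top ((Measure.measurable_lintegral hf.enorm).comp hκ)
    (ne_top_of_le_ne_top hint.2.ne (lintegral_lintegral_le_of_mean_le hκ hle hf.enorm))] with ω hω
  exact ⟨hf.aestronglyMeasurable, hω⟩

lemma lintegral_edist_integral_le_of_mean_le {κ : Ω → Measure X} (hκ : Measurable κ)
    (hle : ∀ E, MeasurableSet E → ∫⁻ ω, κ ω E ∂P ≤ ρ E) {f g : X → ℝ} (hf : Measurable f)
    (hfi : Integrable f ρ) (hg : Measurable g) (hgi : Integrable g ρ) :
    ∫⁻ ω, edist (∫ x, f x ∂(κ ω)) (∫ x, g x ∂(κ ω)) ∂P ≤ eLpNorm (f - g) 1 ρ := by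
  rw [eLpNorm_one_eq_lintegral_enorm]
  refine le_trans (lintegral_mono_ae ?_)
    (lintegral_enorm_integral_le_of_mean_le hκ hle (hf.sub hg))
  filter_upwards [ae_integrable_of_mean_le hκ hle hf hfi, ae_integrable_of_mean_le hκ hle hg hgi]
    with ω h1 h2
  rw [edist_eq_enorm_sub, ← integral_sub h1 h2]
  rfl

lemma measurable_integral_of_measurable_measure {κ : Ω → Measure X} (hκ : Measurable κ)
    {f : X → ℝ} (hf : Measurable f) : Measurable fun ω ↦ ∫ x, f x ∂(κ ω) :=
  (hf.stronglyMeasurable.integral_kernel (κ := (⟨κ, hκ⟩ : Kernel Ω X))).measurable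

lemma tendsto_measure_of_tendsto_measureReal {μs : ℕ → Measure X} [∀ k, IsFiniteMeasure (μs k)]
    {E : Set X} {z : ℝ} (h : Tendsto (fun k ↦ (μs k).real E) atTop (𝓝 z)) :
    Tendsto (fun k ↦ μs k E) atTop (𝓝 (ENNReal.ofReal z)) := by
  simpa using ENNReal.tendsto_ofReal h

variable {μs : ℕ → Ω → Measure X} [∀ k ω, IsFiniteMeasure (μs k ω)]

lemma lintegral_edist_measureReal_le_of_mean_le {κ : Ω → Measure X} [∀ ω, IsFiniteMeasure (κ ω)]
    (hle : ∀ E, MeasurableSet E → ∫⁻ ω, κ ω E ∂P ≤ ρ E) {E K : Set X} (hE : MeasurableSet E)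
    (hK : MeasurableSet K) (hKE : K ⊆ E) :
    ∫⁻ ω, edist ((κ ω).real E) ((κ ω).real K) ∂P ≤ ρ (E \ K) := by
  refine (lintegral_mono fun ω ↦ ?_).trans (hle _ (hE.diff hK))
  rw [edist_eq_enorm_sub, ← measureReal_sdiff hKE hK, Real.enorm_of_nonneg measureReal_nonneg,
    ofReal_measureReal]

lemma edist_toReal_liminf_measure_le {κ : ℕ → Measure X} [∀ k, IsFiniteMeasure (κ k)]
    {E K : Set X} (hKE : K ⊆ E) {z : ℝ}
    (hz : Tendsto (fun k ↦ (κ k).real K) atTop (𝓝 z))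
    (hfin : liminf (fun k ↦ κ k E) atTop ≠ ∞) :
    edist (liminf (fun k ↦ κ k E) atTop).toReal z ≤ liminf (fun k ↦ κ k (E \ K)) atTop := by
  have hz0 : 0 ≤ z := ge_of_tendsto' hz fun k ↦ measureReal_nonneg
  have hlim := tendsto_measure_of_tendsto_measureReal hz
  have h1 : ENNReal.ofReal z ≤ liminf (fun k ↦ κ k E) atTop := by
    rw [← hlim.liminf_eq]
    exact liminf_le_liminf (.of_forall fun k ↦ measure_mono hKE)
  have h2 : liminf (fun k ↦ κ k E) atTop
      ≤ ENNReal.ofReal z + liminf (fun k ↦ κ k (E \ K)) atTop := by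
    refine ENNReal.le_of_forall_pos_le_add fun ε hε _ ↦ ?_
    have hev : ∀ᶠ k in atTop, κ k E ≤ ENNReal.ofReal z + ε + κ k (E \ K) := by
      filter_upwards [hlim.eventually_lt_const
        (ENNReal.lt_add_right ENNReal.ofReal_ne_top (ENNReal.coe_pos.2 hε).ne')] with k hk
      calc κ k E = κ k (K ∪ E \ K) := by rw [union_sdiff_cancel hKE]
        _ ≤ κ k K + κ k (E \ K) := measure_union_le _ _
        _ ≤ _ := by gcongr
    refine (liminf_le_liminf hev).trans_eq ?_
    rw [liminf_const_add atTop _ _ (by isBoundedDefault) (by isBoundedDefault), add_right_comm]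
  have h3 : z ≤ (liminf (fun k ↦ κ k E) atTop).toReal := (ENNReal.ofReal_le_iff_le_toReal hfin).1 h1
  rw [edist_eq_enorm_sub, Real.enorm_of_nonneg (sub_nonneg.2 h3), ENNReal.ofReal_sub _ hz0,
    ENNReal.ofReal_toReal hfin]
  exact tsub_le_iff_left.2 h2

/-- If the mean measures are dominated by a single finite inner regular measure, then convergence
in measure of the masses of compact sets extends to all measurable sets. -/
lemma exists_tendstoInMeasure_measureReal [TopologicalSpace X] [T2Space X] [OpensMeasurableSpace X]
    [IsFiniteMeasure ρ] [ρ.InnerRegularCompactLTTop] (hmeas : ∀ k, Measurable (μs k))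
    (hle : ∀ k E, MeasurableSet E → ∫⁻ ω, μs k ω E ∂P ≤ ρ E)
    (hconv : ∀ A : Set X, IsCompact A →
      ∃ Z : Ω → ℝ, TendstoInMeasure P (fun k ω ↦ (μs k ω).real A) atTop Z)
    {E : Set X} (hE : MeasurableSet E) :
    ∃ Z : Ω → ℝ, Measurable Z ∧ 0 ≤ Z ∧ TendstoInMeasure P (fun k ω ↦ (μs k ω).real E) atTop Z := by
  have hmeasE : ∀ {S : Set X}, MeasurableSet S → ∀ k, Measurable fun ω ↦ μs k ω S := fun hS k ↦
    (Measure.measurable_coe hS).comp (hmeas k)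
  have hmeasR : ∀ {S : Set X}, MeasurableSet S → ∀ k, Measurable fun ω ↦ (μs k ω).real S :=
    fun hS k ↦ (hmeasE hS k).ennreal_toReal
  have hK : ∀ n : ℕ, ∃ K ⊆ E, IsCompact K ∧ ρ (E \ K) < 2⁻¹ ^ n := fun n ↦
    hE.exists_isCompact_sdiff_lt (measure_ne_top _ _) (ENNReal.pow_pos (by simp) n).ne'
  choose K hKE hKc hKlt using hK
  have hKm : ∀ n, MeasurableSet (K n) := fun n ↦ (hKc n).measurableSet
  have hlimK : ∀ n, ∃ Z : Ω → ℝ, Measurable Z ∧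
      TendstoInMeasure P (fun k ω ↦ (μs k ω).real (K n)) atTop Z := fun n ↦ by
    obtain ⟨Z, hZ⟩ := hconv (K n) (hKc n)
    have hae := hZ.aemeasurable fun k ↦ (hmeasR (hKm n) k).aemeasurable
    exact ⟨hae.mk Z, hae.measurable_mk, hZ.congr_right hae.ae_eq_mk⟩
  choose Z hZm hZ using hlimK
  obtain ⟨ns, -, hns⟩ := exists_seq_forall_tendsto_ae hZ
  have hLm : Measurable fun ω ↦ liminf (fun k ↦ μs (ns k) ω E) atTop :=
    Measurable.liminf fun k ↦ hmeasE hE (ns k)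
  have fatou : ∀ {S : Set X}, MeasurableSet S →
      ∫⁻ ω, liminf (fun k ↦ μs (ns k) ω S) atTop ∂P ≤ ρ S := fun hS ↦
    (lintegral_liminf_le fun k ↦ hmeasE hS (ns k)).trans
      ((liminf_le_liminf (.of_forall fun k ↦ hle (ns k) _ hS)).trans_eq (liminf_const _))
  refine ⟨fun ω ↦ (liminf (fun k ↦ μs (ns k) ω E) atTop).toReal, hLm.ennreal_toReal,
    fun ω ↦ ENNReal.toReal_nonneg, ?_⟩
  refine tendstoInMeasure_of_forall_lintegral_edist_le (hmeasR hE) hLm.ennreal_toReal fun δ hδ ↦ ?_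
  obtain ⟨n, hn⟩ := ((ENNReal.tendsto_pow_atTop_nhds_zero_of_lt_one (r := 2⁻¹)
    (by simp)).eventually_lt_const hδ).exists
  refine ⟨_, Z n, hmeasR (hKm n), hZm n, hZ n, fun k ↦ ?_, ?_⟩
  · exact (lintegral_edist_measureReal_le_of_mean_le (hle k) hE (hKm n) (hKE n)).trans
      ((hKlt n).trans hn).le
  · refine le_trans (lintegral_mono_ae ?_)
      ((fatou (hE.diff (hKm n))).trans ((hKlt n).trans hn).le)
    filter_upwards [hns, ae_lt_top hLm (ne_top_of_le_ne_top (measure_ne_top ρ E) (fatou hE))]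
      with ω h1 h2
    exact edist_toReal_liminf_measure_le (hKE n) (h1 n) h2.ne

/-- Limits in measure of the masses of measurable sets are the masses of a random measure. -/
lemma exists_measure_tendstoInMeasure_measureReal [StandardBorelSpace X] [IsFiniteMeasure ρ]
    (hmeas : ∀ k, Measurable (μs k))
    (hle : ∀ k E, MeasurableSet E → ∫⁻ ω, μs k ω E ∂P ≤ ρ E)
    (hconv : ∀ E : Set X, MeasurableSet E → ∃ Z : Ω → ℝ, Measurable Z ∧ 0 ≤ Z ∧
      TendstoInMeasure P (fun k ω ↦ (μs k ω).real E) atTop Z) :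
    ∃ μ : Ω → Measure X, (∀ ω, IsFiniteMeasure (μ ω)) ∧ Measurable μ ∧
      (∀ E, MeasurableSet E → ∫⁻ ω, μ ω E ∂P ≤ ρ E) ∧
      ∀ E, MeasurableSet E → TendstoInMeasure P (fun k ω ↦ (μs k ω).real E) atTop
        (fun ω ↦ (μ ω).real E) := by
  choose! Z hZm hZ0 hZ using hconv
  have hcont : IsRandomContent P ρ fun E ω ↦ ENNReal.ofReal (Z E ω) := by
    refine ⟨fun E hE ↦ (hZm E hE).ennreal_ofReal, fun A B hA hB hAB ↦ ?_, fun E hE ↦ ?_⟩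
    · have hABm : ∀ i : Fin 3, MeasurableSet (![A, B, A ∪ B] i) := by
        simp [Fin.forall_fin_succ, hA, hB, hA.union hB]
      obtain ⟨ns, -, hns⟩ := exists_seq_forall_tendsto_ae fun i ↦ hZ _ (hABm i)
      filter_upwards [hns] with ω hω
      have hA' := tendsto_measure_of_tendsto_measureReal (hω 0)
      have hB' := tendsto_measure_of_tendsto_measureReal (hω 1)
      have hAB' := tendsto_measure_of_tendsto_measureReal (hω 2)
      exact tendsto_nhds_unique hAB'
        ((hA'.add hB').congr fun k ↦ (measure_union hAB hB).symm)
    · obtain ⟨ns, -, hns⟩ := (hZ E hE).exists_seq_tendsto_ae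
      calc ∫⁻ ω, ENNReal.ofReal (Z E ω) ∂P
          = ∫⁻ ω, liminf (fun k ↦ μs (ns k) ω E) atTop ∂P := by
            refine lintegral_congr_ae ?_
            filter_upwards [hns] with ω hω
            exact (tendsto_measure_of_tendsto_measureReal hω).liminf_eq.symm
        _ ≤ liminf (fun k ↦ ∫⁻ ω, μs (ns k) ω E ∂P) atTop :=
            lintegral_liminf_le fun k ↦ (Measure.measurable_coe hE).comp (hmeas (ns k))
        _ ≤ ρ E := (liminf_le_liminf (.of_forall fun k ↦ hle (ns k) E hE)).trans_eq
            (liminf_const _)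
  obtain ⟨μ, hfin, hμm, hμ⟩ := hcont.exists_measure
  refine ⟨μ, hfin, hμm, fun E hE ↦ ?_, fun E hE ↦ ?_⟩
  · exact (lintegral_congr_ae (hμ E hE)).trans_le (hcont.lintegral_le E hE)
  · refine (hZ E hE).congr_right ?_
    filter_upwards [hμ E hE] with ω hω
    rw [Measure.real, hω, ENNReal.toReal_ofReal (hZ0 E hE ω)]

variable {μ : Ω → Measure X} [∀ ω, IsFiniteMeasure (μ ω)]

lemma tendstoInMeasure_integral_simpleFunc [IsFiniteMeasure P] (hmeas : ∀ k, Measurable (μs k))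
    (hlim : ∀ E, MeasurableSet E → TendstoInMeasure P (fun k ω ↦ (μs k ω).real E) atTop
      (fun ω ↦ (μ ω).real E)) (s : SimpleFunc X ℝ) :
    TendstoInMeasure P (fun k ω ↦ ∫ x, s x ∂(μs k ω)) atTop (fun ω ↦ ∫ x, s x ∂(μ ω)) := by
  refine (exists_seq_tendstoInMeasure_atTop_iff fun k ↦
    (measurable_integral_of_measurable_measure (hmeas k) s.measurable).aestronglyMeasurable).2
    fun ns hns ↦ ?_
  obtain ⟨ns', hns', h⟩ := exists_seq_forall_tendsto_ae fun y : s.range ↦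
    (hlim _ (s.measurableSet_fiber y)).comp hns.tendsto_atTop
  refine ⟨ns', hns', ?_⟩
  filter_upwards [h] with ω hω
  have hsum : ∀ (κ : Measure X) [IsFiniteMeasure κ],
      ∫ x, s x ∂κ = ∑ y ∈ s.range, κ.real (s ⁻¹' {y}) • y := fun κ _ ↦ by
    rw [← s.integral_eq_integral s.integrable_of_isFiniteMeasure, SimpleFunc.integral_eq]
  simp only [hsum]
  exact tendsto_finsetSum _ fun y hy ↦ (hω ⟨y, hy⟩).smul_const y

lemma tendstoInMeasure_integral [IsFiniteMeasure P] [IsFiniteMeasure ρ]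
    (hmeas : ∀ k, Measurable (μs k)) (hle : ∀ k E, MeasurableSet E → ∫⁻ ω, μs k ω E ∂P ≤ ρ E)
    (hμ : Measurable μ) (hμle : ∀ E, MeasurableSet E → ∫⁻ ω, μ ω E ∂P ≤ ρ E)
    (hlim : ∀ E, MeasurableSet E → TendstoInMeasure P (fun k ω ↦ (μs k ω).real E) atTop
      (fun ω ↦ (μ ω).real E)) {f : X → ℝ} (hf : Measurable f) (hint : Integrable f ρ) :
    TendstoInMeasure P (fun k ω ↦ ∫ x, f x ∂(μs k ω)) atTop (fun ω ↦ ∫ x, f x ∂(μ ω)) := by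
  refine tendstoInMeasure_of_forall_lintegral_edist_le
    (fun k ↦ measurable_integral_of_measurable_measure (hmeas k) hf)
    (measurable_integral_of_measurable_measure hμ hf) fun δ hδ ↦ ?_
  obtain ⟨s, hs, -⟩ := (memLp_one_iff_integrable.2 hint).exists_simpleFunc_eLpNorm_sub_lt
    (by simp) hδ.ne'
  have hsi : Integrable s ρ := s.integrable_of_isFiniteMeasure
  exact ⟨_, _, fun k ↦ measurable_integral_of_measurable_measure (hmeas k) s.measurable,
    measurable_integral_of_measurable_measure hμ s.measurable,
    tendstoInMeasure_integral_simpleFunc hmeas hlim s,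
    fun k ↦ (lintegral_edist_integral_le_of_mean_le (hmeas k) (hle k) hf hint s.measurable
      hsi).trans hs.le,
    (lintegral_edist_integral_le_of_mean_le hμ hμle hf hint s.measurable hsi).trans hs.le⟩

lemma weakSubseqInProb_of_tendstoInMeasure [TopologicalSpace X] [SecondCountableTopology X]
    [OpensMeasurableSpace X] [IsProbabilityMeasure P]
    (hlim : ∀ E, MeasurableSet E → TendstoInMeasure P (fun k ω ↦ (μs k ω).real E) atTop
      (fun ω ↦ (μ ω).real E)) : WeakSubseqInProb P μs μ := by
  intro α hα
  set B := TopologicalSpace.countableBasis X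
  set 𝒢 : Set (Set X) := insert univ (sUnion '' {s | s.Finite ∧ s ⊆ B})
  have h𝒢 : 𝒢.Countable := ((countable_ofPred_finite_subset
    (TopologicalSpace.countable_countableBasis X)).image _).insert _
  have h𝒢m : ∀ G : 𝒢, MeasurableSet (G : Set X) := by
    rintro ⟨G, rfl | ⟨s, hs, rfl⟩⟩
    · exact .univ
    · exact (isOpen_sUnion fun u hu ↦
        TopologicalSpace.isOpen_of_mem_countableBasis (hs.2 hu)).measurableSet
  have := h𝒢.to_subtype
  obtain ⟨ns, hns, h⟩ := exists_seq_forall_tendsto_ae fun G : 𝒢 ↦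
    (hlim G (h𝒢m G)).comp hα.tendsto_atTop
  obtain ⟨N, hN, hNm, hN0⟩ := exists_measurable_superset_of_null (ae_iff.1 h)
  refine ⟨α ∘ ns, hα.comp hns, range_comp_subset_range _ _, Nᶜ, hNm.compl,
    (prob_compl_eq_one_iff hNm).2 hN0, fun ω hω f ↦ ?_⟩
  have hω' := not_not.1 fun hc ↦ hω (hN hc)
  exact tendsto_integral_of_tendsto_finite_sUnion (TopologicalSpace.countable_countableBasis X)
    (TopologicalSpace.isBasis_countableBasis X)
    (fun s hs hsf ↦ hω' ⟨⋃₀ s, mem_insert_of_mem _ ⟨s, ⟨hsf, hs⟩, rfl⟩⟩)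
    (hω' ⟨univ, mem_insert _ _⟩) f

end RandomMeasure

/-- **Representation theorem for absolutely continuous random measures.**  If the random
finite measures `μ_k` have densities `g k` with respect to a finite measure `ν` with
`E(g k x) ≤ c`, and `μ_k(A)` converges in probability for every compact `A`, then `μ_k`
weakly converges subsequentially in probability to a random finite Borel measure `μ`;
moreover for every Borel `f` with `∫|f| dν < ∞` the integrals `∫ f dμ_k` converge in
probability to `∫ f dμ`, whose expected absolute value is at most `c·∫|f| dν`. -/
theorem random_measures_weak_subseq_limit_of_density_bound
    {X : Type*} [MetricSpace X] [CompleteSpace X] [TopologicalSpace.SeparableSpace X]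
    [MeasurableSpace X] [BorelSpace X]
    {Ω : Type*} [MeasurableSpace Ω] (P : Measure Ω) [IsProbabilityMeasure P]
    (ν : Measure X) [IsFiniteMeasure ν]
    (c : NNReal)
    (μs : ℕ → Ω → Measure X)
    (hfin : ∀ k ω, IsFiniteMeasure (μs k ω))
    (hmeas : ∀ (k : ℕ) (E : Set X), MeasurableSet E → Measurable fun ω => μs k ω E)
    (g : ℕ → X → Ω → NNReal)
    (hgmeas : ∀ k, Measurable fun p : X × Ω => g k p.1 p.2)
    (hdens : ∀ k, ∀ᵐ ω ∂P, ∀ E : Set X, MeasurableSet E →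
      μs k ω E = ∫⁻ x in E, (g k x ω : ENNReal) ∂ν)
    (hexp : ∀ (k : ℕ) (x : X), ∫⁻ ω, (g k x ω : ENNReal) ∂P ≤ (c : ENNReal))
    (hconv : ∀ A : Set X, IsCompact A →
      ∃ Z : Ω → ℝ, TendstoInMeasure P (fun k ω => (μs k ω A).toReal) atTop Z) :
    ∃ μ : Ω → Measure X,
      (∀ ω, IsFiniteMeasure (μ ω)) ∧
      (∀ E : Set X, MeasurableSet E → Measurable fun ω => μ ω E) ∧
      WeakSubseqInProb P μs μ ∧
      ∀ f : X → ℝ, Measurable f → Integrable f ν →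
        TendstoInMeasure P (fun k ω => ∫ x, f x ∂(μs k ω)) atTop
          (fun ω => ∫ x, f x ∂(μ ω)) ∧
        ∫⁻ ω, (‖∫ x, f x ∂(μ ω)‖₊ : ENNReal) ∂P
          ≤ (c : ENNReal) * ∫⁻ x, (‖f x‖₊ : ENNReal) ∂ν := by
  have hmeas' : ∀ k, Measurable (μs k) := fun k ↦
    Measure.measurable_of_measurable_coe _ fun E hE ↦ hmeas k E hE
  have hle : ∀ k E, MeasurableSet E → ∫⁻ ω, μs k ω E ∂P ≤ (c • ν) E := fun k E hE ↦
    calc ∫⁻ ω, μs k ω E ∂P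
        = ∫⁻ ω, ∫⁻ x in E, (g k x ω : ENNReal) ∂ν ∂P :=
          lintegral_congr_ae ((hdens k).mono fun ω hω ↦ hω E hE)
      _ = ∫⁻ x in E, ∫⁻ ω, (g k x ω : ENNReal) ∂P ∂ν :=
          lintegral_lintegral_swap
            ((hgmeas k).comp measurable_swap).coe_nnreal_ennreal.aemeasurable
      _ ≤ ∫⁻ _ in E, (c : ENNReal) ∂ν := lintegral_mono fun x ↦ hexp k x
      _ = (c • ν) E := setLIntegral_const E _
  obtain ⟨μ, hμfin, hμ, hμle, hlim⟩ := exists_measure_tendstoInMeasure_measureReal hmeas' hle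
    fun E hE ↦ exists_tendstoInMeasure_measureReal hmeas' hle hconv hE
  refine ⟨μ, hμfin, fun E hE ↦ (Measure.measurable_coe hE).comp hμ,
    weakSubseqInProb_of_tendstoInMeasure hlim, fun f hf hint ↦
    ⟨tendstoInMeasure_integral hmeas' hle hμ hμle hlim hf hint.smul_measure_nnreal, ?_⟩⟩
  refine (lintegral_enorm_integral_le_of_mean_le hμ hμle hf).trans_eq ?_
  rw [lintegral_smul_measure]
  rfl
end

section
/- Let X be a complete separable metric space, φ a regularity kernel with φ(0) = ∞, (Ω, 𝒜, P) a probability space, B : Ω → Set X a random set, and for each k ∈ ℕ let 𝒬_k be a countable family of pairwise disjoint Borel subsets of X with {ω : B(ω) ∩ Q ≠ ∅} measurable and P(B ∩ Q ≠ ∅) > 0 for every Q ∈ 𝒬_k, such that sup{diam Q : Q ∈ 𝒬_k} → 0 as k → ∞ and every Q ∈ 𝒬_k (k > 1) is contained in a unique element of 𝒬_{k−1}. Assume: (1) there exists 0 < M < ∞ with 0 < diam(Q)/M ≤ diam(S) ≤ diam(Q)·M < ∞ for all Q, S ∈ 𝒬_k and all k; (2) there exists a > 0 with a · C_φ(Q)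 ≤ P(B ∩ Q ≠ ∅) for every Q ∈ 𝒬_k and every k; (3) there exist 0 < δ < 1 and c₂, c₃ < ∞ with φ(r) ≤ c₂ · φ(r(1+2δ)) + c₃ for all r > 0; (4) there exists c < ∞ such that whenever Q ∈ 𝒬_k, S ∈ 𝒬_n and max(diam Q, diam S) < δ · dist(Q, S), then P(B ∩ Q ≠ ∅ and B ∩ S ≠ ∅) ≤ c · P(B ∩ Q ≠ ∅) · P(B ∩ S ≠ ∅) · φ(dist(Q, S)); (5) there exists M_δ < ∞ such that for every k and every Q ∈ 𝒬_k, the set {S ∈ 𝒬_k : max(diam Q, diam S) ≥ δ · dist(Q, S)} has at most M_δ elements. Let ν be a finite Borel measure on X with ν(X ∖ X₀) = 0 and I_φ(ν) < ∞, and suppose F̲(x,y) = F̄(x,y) for ν×ν-almost every (x,y). Then for every Borel set A ⊆ X there exists a square-integrable random variable μ(A) such that E( |𝒞_k(ν)(A) − μ(A)|² ) → 0 as k → ∞ (hence 𝒞_k(ν)(A) → μ(A) in L¹ and in probability), and E(μ(A)) = ν(A). -/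
open MeasureTheory Filter Set Topology Classical

/-- The `φ`-energy of a Borel measure: `I_φ(ν) = ∫∫ φ(d(x,y)) dν(x) dν(y)`. -/
noncomputable def phiEnergy {X : Type*} [MetricSpace X] [MeasurableSpace X]
    (φ : ℝ → ENNReal) (ν : Measure X) : ENNReal :=
  ∫⁻ x, ∫⁻ y, φ (dist x y) ∂ν ∂ν

/-- The `φ`-capacity of a set `K`: the supremum of `I_φ(τ)⁻¹` over Borel probability
measures `τ` supported in `K` (value `0` if there is no such measure). -/
noncomputable def phiCapacity {X : Type*} [MetricSpace X] [MeasurableSpace X]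
    (φ : ℝ → ENNReal) (K : Set X) : ENNReal :=
  ⨆ (τ : Measure X) (_ : IsProbabilityMeasure τ) (_ : τ Kᶜ = 0), (phiEnergy φ τ)⁻¹

/-- The (extended) distance between two sets: `inf {edist x y : x ∈ Q, y ∈ S}`. -/
noncomputable def setEDist {X : Type*} [PseudoEMetricSpace X] (Q S : Set X) : ENNReal :=
  ⨅ (x ∈ Q) (y ∈ S), edist x y

/-- `𝒞_k(ν)(A)(ω) = Σ_{Q ∈ 𝒬} P(B∩Q≠∅)⁻¹ · 1_{B(ω)∩Q≠∅} · ν(Q∩A)`, the conditional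
measure approximation associated with a family `𝒬` of sets. -/
noncomputable def condCk {X Ω : Type*} [MeasurableSpace X] [MeasurableSpace Ω]
    (P : Measure Ω) (B : Ω → Set X) (𝒬 : Set (Set X)) (ν : Measure X) (A : Set X)
    (ω : Ω) : ENNReal :=
  ∑' Q : 𝒬, (P {ω' | (B ω' ∩ (Q : Set X)).Nonempty})⁻¹ *
    (if (B ω ∩ (Q : Set X)).Nonempty then ν ((Q : Set X) ∩ A) else 0)

/-- `F_{k,n}(x,y)`: the correlation ratio
`P(Q_k(x) ∩ B ≠ ∅ ∧ Q_n(y) ∩ B ≠ ∅) / (P(Q_k(x) ∩ B ≠ ∅) · P(Q_n(y) ∩ B ≠ ∅))`, where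
`Q_k(x)` is the (unique, by pairwise disjointness) element of the family containing `x`;
the value is `0` if `x` (or `y`) lies in no element of the corresponding family.  (As the
families are pairwise disjoint, at most one summand below is nonzero.) -/
noncomputable def condF {X Ω : Type*} [MeasurableSpace Ω]
    (P : Measure Ω) (B : Ω → Set X) (𝒬k 𝒬n : Set (Set X)) (x y : X) : ENNReal :=
  ∑' Q : 𝒬k, ∑' S : 𝒬n,
    if x ∈ (Q : Set X) ∧ y ∈ (S : Set X) then
      P {ω | (B ω ∩ (Q : Set X)).Nonempty ∧ (B ω ∩ (S : Set X)).Nonempty} /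
        (P {ω | (B ω ∩ (Q : Set X)).Nonempty} * P {ω | (B ω ∩ (S : Set X)).Nonempty})
    else 0

/-- `F̄(x,y) = lim_N sup_{k,n ≥ N} F_{k,n}(x,y)` (a decreasing limit of suprema). -/
noncomputable def condFup {X Ω : Type*} [MeasurableSpace Ω]
    (P : Measure Ω) (B : Ω → Set X) (𝒬 : ℕ → Set (Set X)) (x y : X) : ENNReal :=
  ⨅ N : ℕ, ⨆ k : ℕ, ⨆ (_ : N ≤ k), ⨆ n : ℕ, ⨆ (_ : N ≤ n), condF P B (𝒬 k) (𝒬 n) x y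

/-- `F̲(x,y) = lim_N inf_{k,n ≥ N} F_{k,n}(x,y)` (an increasing limit of infima). -/
noncomputable def condFlow {X Ω : Type*} [MeasurableSpace Ω]
    (P : Measure Ω) (B : Ω → Set X) (𝒬 : ℕ → Set (Set X)) (x y : X) : ENNReal :=
  ⨆ N : ℕ, ⨅ k : ℕ, ⨅ (_ : N ≤ k), ⨅ n : ℕ, ⨅ (_ : N ≤ n), condF P B (𝒬 k) (𝒬 n) x y

/-- For nonnegative reals, the symmetric truncated difference in `ENNReal` is the absolute value
of the difference. -/
lemma ofReal_tsub_add_tsub {r s : ℝ} (hr : 0 ≤ r) (hs : 0 ≤ s) :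
    (ENNReal.ofReal r - ENNReal.ofReal s) + (ENNReal.ofReal s - ENNReal.ofReal r) =
      ‖r - s‖ₑ := by
  rw [← ENNReal.ofReal_sub _ hs, ← ENNReal.ofReal_sub _ hr, Real.enorm_eq_ofReal_abs]
  rcases le_total r s with h | h
  · rw [ENNReal.ofReal_of_nonpos (sub_nonpos.2 h), zero_add, abs_of_nonpos (sub_nonpos.2 h),
      neg_sub]
  · rw [ENNReal.ofReal_of_nonpos (sub_nonpos.2 h), add_zero, abs_of_nonneg (sub_nonneg.2 h)]

lemma tsub_add_tsub_le_enorm {a : ENNReal} (ha : a ≠ ⊤) (s : ℝ) :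
    (a - ENNReal.ofReal s) + (ENNReal.ofReal s - a) ≤ ‖a.toReal - s‖ₑ := by
  have h1 : ENNReal.ofReal s = ENNReal.ofReal (max s 0) := by
    rcases le_total s 0 with h | h <;> simp [h]
  rw [h1]
  nth_rewrite 1 2 [← ENNReal.ofReal_toReal ha]
  rw [ofReal_tsub_add_tsub ENNReal.toReal_nonneg (le_max_right _ _), Real.enorm_eq_ofReal_abs,
    Real.enorm_eq_ofReal_abs]
  refine ENNReal.ofReal_le_ofReal ?_
  have h2 : a.toReal = max a.toReal 0 := by simp
  rw [h2]
  nth_rewrite 2 [← h2]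
  exact abs_max_sub_max_le_abs _ _ _

lemma tsub_add_tsub_sq_add_le (a b : ENNReal) :
    ((a - b) + (b - a)) ^ 2 + 2 * (a * b) ≤ a ^ 2 + b ^ 2 := by
  wlog h : b ≤ a generalizing a b
  · have := this b a (le_of_not_ge h)
    rwa [add_comm (b - a), mul_comm b, add_comm (b ^ 2)] at this
  · rw [tsub_eq_zero_of_le h, add_zero]
    obtain ⟨d, rfl⟩ := exists_add_of_le h
    have : b + d - b ≤ d := tsub_le_iff_left.2 le_rfl
    calc (b + d - b) ^ 2 + 2 * ((b + d) * b) ≤ d ^ 2 + 2 * ((b + d) * b) := by gcongr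
      _ = (b + d) ^ 2 + b ^ 2 := by ring

lemma eLpNorm_two_sq {α E : Type*} [MeasurableSpace α] [NormedAddCommGroup E] (μ : Measure α)
    (f : α → E) : eLpNorm f 2 μ ^ 2 = ∫⁻ x, ‖f x‖ₑ ^ 2 ∂μ := by
  have := eLpNorm_nnreal_pow_eq_lintegral (μ := μ) (f := f) (p := 2) two_ne_zero
  simpa using this

lemma ENNReal.tendsto_zero_of_sq {ι : Type*} {l : Filter ι} {u : ι → ENNReal}
    (h : Tendsto (fun i => u i ^ 2) l (𝓝 0)) : Tendsto u l (𝓝 0) := by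
  have h' := h.ennrpow_const ((2 : ℕ) : ℝ)⁻¹
  rw [ENNReal.zero_rpow_of_pos (by norm_num)] at h'
  exact h'.congr fun i => ENNReal.pow_rpow_inv_natCast two_ne_zero (u i)

lemma lintegral_le_lintegral_sq {Ω : Type*} [MeasurableSpace Ω] (P : Measure Ω)
    [IsProbabilityMeasure P] {f : Ω → ENNReal} (hf : Measurable f) :
    (∫⁻ ω, f ω ∂P) ^ 2 ≤ ∫⁻ ω, f ω ^ 2 ∂P := by
  have := ENNReal.lintegral_mul_le_Lp_mul_Lq P Real.HolderConjugate.two_two hf.aemeasurable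
    (aemeasurable_const (b := (1 : ENNReal)))
  simp only [Pi.mul_apply, mul_one, ENNReal.one_rpow, lintegral_const, measure_univ] at this
  calc (∫⁻ ω, f ω ∂P) ^ 2 ≤ ((∫⁻ ω, f ω ^ (2 : ℝ) ∂P) ^ (1 / 2 : ℝ)) ^ 2 := by gcongr
    _ = ∫⁻ ω, f ω ^ 2 ∂P := by
      have h := ENNReal.rpow_inv_natCast_pow two_ne_zero (∫⁻ ω, f ω ^ (2 : ℝ) ∂P)
      simpa using h

/-- A sequence of `ENNReal`-valued random variables that is Cauchy in `L²` and has constant mean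
converges in `L²` to a random variable with the same mean. -/
lemma exists_tendsto_L2_of_cauchy {Ω : Type*} [MeasurableSpace Ω] (P : Measure Ω)
    [IsProbabilityMeasure P] {C : ℕ → Ω → ENNReal} (hC : ∀ k, Measurable (C k))
    (h2 : ∀ k, ∫⁻ ω, C k ω ^ 2 ∂P ≠ ⊤) {m : ENNReal} (hm : ∀ k, ∫⁻ ω, C k ω ∂P = m)
    (hcau : Tendsto (fun p : ℕ × ℕ =>
      ∫⁻ ω, ((C p.1 ω - C p.2 ω) + (C p.2 ω - C p.1 ω)) ^ 2 ∂P) atTop (𝓝 0)) :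
    ∃ Y : Ω → ENNReal, Measurable Y ∧ (∫⁻ ω, Y ω ^ 2 ∂P) < ⊤ ∧
      Tendsto (fun k : ℕ => ∫⁻ ω, ((C k ω - Y ω) + (Y ω - C k ω)) ^ 2 ∂P) atTop (𝓝 0) ∧
      ∫⁻ ω, Y ω ∂P = m := by
  have hfin : ∀ k, ∀ᵐ ω ∂P, C k ω ≠ ⊤ := fun k => by
    filter_upwards [ae_lt_top ((hC k).pow_const 2) (h2 k)] with ω hω h
    simp [h] at hω
  have hmem : ∀ k, MemLp (fun ω => (C k ω).toReal) 2 P := fun k => by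
    refine ⟨(hC k).ennreal_toReal.aestronglyMeasurable, ?_⟩
    have h := eLpNorm_two_sq P (fun ω => (C k ω).toReal)
    have h' : ∫⁻ ω, ‖(C k ω).toReal‖ₑ ^ 2 ∂P ≤ ∫⁻ ω, C k ω ^ 2 ∂P := by
      refine lintegral_mono fun ω => ?_
      gcongr
      rw [Real.enorm_of_nonneg ENNReal.toReal_nonneg]
      exact ENNReal.ofReal_toReal_le
    rw [← h] at h'
    have := h'.trans_lt (h2 k).lt_top
    exact (ENNReal.pow_lt_top_iff.1 this).resolve_right two_ne_zero
  have hcs : CauchySeq fun k => (hmem k).toLp := by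
    rw [Lp.cauchySeq_Lp_iff_cauchySeq_eLpNorm]
    refine ENNReal.tendsto_zero_of_sq (hcau.congr fun p => ?_)
    rw [eLpNorm_two_sq]
    refine lintegral_congr_ae ?_
    filter_upwards [hfin p.1, hfin p.2, (hmem p.1).coeFn_toLp, (hmem p.2).coeFn_toLp]
      with ω h1 h2 h3 h4
    rw [Pi.sub_apply, h3, h4, ← ofReal_tsub_add_tsub ENNReal.toReal_nonneg ENNReal.toReal_nonneg,
      ENNReal.ofReal_toReal h1, ENNReal.ofReal_toReal h2]
  obtain ⟨g, hg⟩ := cauchySeq_tendsto_of_complete hcs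
  rw [Lp.tendsto_Lp_iff_tendsto_eLpNorm'] at hg
  have hgm : Measurable g := (Lp.stronglyMeasurable g).measurable
  have hYm : Measurable fun ω => ENNReal.ofReal (g ω) := hgm.ennreal_ofReal
  have hconv : Tendsto (fun k : ℕ => ∫⁻ ω, ((C k ω - ENNReal.ofReal (g ω)) +
      (ENNReal.ofReal (g ω) - C k ω)) ^ 2 ∂P) atTop (𝓝 0) := by
    have h0 : Tendsto (fun k => eLpNorm (⇑(hmem k).toLp - ⇑g) 2 P ^ 2) atTop (𝓝 0) := by
      simpa using ENNReal.Tendsto.pow (n := 2) hg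
    refine tendsto_of_tendsto_of_tendsto_of_le_of_le tendsto_const_nhds h0 (fun _ => zero_le)
      fun k => ?_
    dsimp only
    rw [eLpNorm_two_sq]
    refine lintegral_mono_ae ?_
    filter_upwards [hfin k, (hmem k).coeFn_toLp] with ω h1 h2
    rw [Pi.sub_apply, h2]
    gcongr
    exact tsub_add_tsub_le_enorm h1 _
  refine ⟨_, hYm, ?_, hconv, ?_⟩
  · calc ∫⁻ ω, ENNReal.ofReal (g ω) ^ 2 ∂P ≤ ∫⁻ ω, ‖g ω‖ₑ ^ 2 ∂P := by
          refine lintegral_mono fun ω => ?_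
          gcongr
          exact Real.ofReal_le_enorm _
      _ = eLpNorm g 2 P ^ 2 := (eLpNorm_two_sq _ _).symm
      _ < ⊤ := ENNReal.pow_lt_top (Lp.memLp g).2
  · have hgap : ∀ k, Measurable fun ω => (C k ω - ENNReal.ofReal (g ω)) +
      (ENNReal.ofReal (g ω) - C k ω) := fun k => ((hC k).sub hYm).add (hYm.sub (hC k))
    have h1 : Tendsto (fun k : ℕ => ∫⁻ ω, ((C k ω - ENNReal.ofReal (g ω)) +
        (ENNReal.ofReal (g ω) - C k ω)) ∂P) atTop (𝓝 0) :=
      ENNReal.tendsto_zero_of_sq <| tendsto_of_tendsto_of_tendsto_of_le_of_le tendsto_const_nhds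
        hconv (fun _ => zero_le) fun k => lintegral_le_lintegral_sq P (hgap k)
    refine le_antisymm ?_ ?_
    · refine ge_of_tendsto' (f := fun k : ℕ => m +
        ∫⁻ ω, ((C k ω - ENNReal.ofReal (g ω)) + (ENNReal.ofReal (g ω) - C k ω)) ∂P)
        (by simpa using tendsto_const_nhds.add h1) fun k => ?_
      rw [← hm k, ← lintegral_add_left (hC k)]
      refine lintegral_mono fun ω => ?_
      calc ENNReal.ofReal (g ω) ≤ C k ω + (ENNReal.ofReal (g ω) - C k ω) := le_add_tsub
        _ ≤ _ := by gcongr; exact le_add_self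
    · refine ge_of_tendsto' (f := fun k : ℕ => (∫⁻ ω, ENNReal.ofReal (g ω) ∂P) +
        ∫⁻ ω, ((C k ω - ENNReal.ofReal (g ω)) + (ENNReal.ofReal (g ω) - C k ω)) ∂P)
        (by simpa using tendsto_const_nhds.add h1) fun k => ?_
      rw [← hm k, ← lintegral_add_left hYm]
      refine lintegral_mono fun ω => ?_
      calc C k ω ≤ ENNReal.ofReal (g ω) + (C k ω - ENNReal.ofReal (g ω)) := le_add_tsub
        _ ≤ _ := by gcongr; exact le_self_add

/-- The function on `X × X` equal to `w Q S` on each block `Q × S`, `Q ∈ 𝒬k`, `S ∈ 𝒬n`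
(for pairwise disjoint families). -/
noncomputable def blockSum {X : Type*} (𝒬k 𝒬n : Set (Set X)) (w : Set X → Set X → ENNReal)
    (p : X × X) : ENNReal :=
  ∑' Q : 𝒬k, ∑' S : 𝒬n, if p.1 ∈ (Q : Set X) ∧ p.2 ∈ (S : Set X) then w Q S else 0

/-- The correlation ratio of the events that `B` hits `Q` and that `B` hits `S`. -/
noncomputable def hitCorr {X Ω : Type*} [MeasurableSpace Ω] (P : Measure Ω) (B : Ω → Set X)
    (Q S : Set X) : ENNReal :=
  P {ω | (B ω ∩ Q).Nonempty ∧ (B ω ∩ S).Nonempty} /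
    (P {ω | (B ω ∩ Q).Nonempty} * P {ω | (B ω ∩ S).Nonempty})

lemma condF_eq_blockSum {X Ω : Type*} [MeasurableSpace Ω] (P : Measure Ω) (B : Ω → Set X)
    (𝒬k 𝒬n : Set (Set X)) (x y : X) :
    condF P B 𝒬k 𝒬n x y = blockSum 𝒬k 𝒬n (hitCorr P B) (x, y) := rfl

section BlockSum

variable {X : Type*} {𝒬k 𝒬n : Set (Set X)}

lemma blockSum_add (w w' : Set X → Set X → ENNReal) (p : X × X) :
    blockSum 𝒬k 𝒬n (fun Q S => w Q S + w' Q S) p =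
      blockSum 𝒬k 𝒬n w p + blockSum 𝒬k 𝒬n w' p := by
  simp only [blockSum, ← ENNReal.tsum_add]
  refine tsum_congr fun Q => tsum_congr fun S => ?_
  split_ifs <;> simp

lemma blockSum_mono {w w' : Set X → Set X → ENNReal} (h : ∀ Q S, w Q S ≤ w' Q S) (p : X × X) :
    blockSum 𝒬k 𝒬n w p ≤ blockSum 𝒬k 𝒬n w' p := by
  refine ENNReal.tsum_le_tsum fun Q => ENNReal.tsum_le_tsum fun S => ?_
  split_ifs
  · exact h _ _
  · exact le_rfl

lemma blockSum_le (hk : ∀ Q ∈ 𝒬k, ∀ S ∈ 𝒬k, Q ≠ S → Q ∩ S = ∅)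
    (hn : ∀ Q ∈ 𝒬n, ∀ S ∈ 𝒬n, Q ≠ S → Q ∩ S = ∅) {w : Set X → Set X → ENNReal} {p : X × X}
    {b : ENNReal} (h : ∀ Q ∈ 𝒬k, ∀ S ∈ 𝒬n, p.1 ∈ Q → p.2 ∈ S → w Q S ≤ b) :
    blockSum 𝒬k 𝒬n w p ≤ b := by
  by_cases h1 : ∃ Q : 𝒬k, p.1 ∈ (Q : Set X)
  swap
  · push Not at h1
    simp [blockSum, h1]
  by_cases h2 : ∃ S : 𝒬n, p.2 ∈ (S : Set X)
  swap
  · push Not at h2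
    simp [blockSum, h2]
  obtain ⟨Q, hQ⟩ := h1
  obtain ⟨S, hS⟩ := h2
  have hQ' : ∀ Q' : 𝒬k, Q' ≠ Q → p.1 ∉ (Q' : Set X) := fun Q' hne hp =>
    (hk _ Q'.2 _ Q.2 (fun e => hne (Subtype.ext e))).le ⟨hp, hQ⟩
  have hS' : ∀ S' : 𝒬n, S' ≠ S → p.2 ∉ (S' : Set X) := fun S' hne hp =>
    (hn _ S'.2 _ S.2 (fun e => hne (Subtype.ext e))).le ⟨hp, hS⟩
  rw [blockSum, tsum_eq_single Q fun Q' hne => by simp [hQ' Q' hne],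
    tsum_eq_single S fun S' hne => by simp [hS' S' hne], if_pos ⟨hQ, hS⟩]
  exact h _ Q.2 _ S.2 hQ hS

variable [MeasurableSpace X]

lemma measurable_block {Q S : Set X} (hQ : MeasurableSet Q) (hS : MeasurableSet S) (c : ENNReal) :
    Measurable fun p : X × X => if p.1 ∈ Q ∧ p.2 ∈ S then c else 0 :=
  Measurable.ite (hQ.prod hS) measurable_const measurable_const

lemma measurable_blockSum (hck : 𝒬k.Countable) (hcn : 𝒬n.Countable)
    (hk : ∀ Q ∈ 𝒬k, MeasurableSet Q) (hn : ∀ Q ∈ 𝒬n, MeasurableSet Q)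
    (w : Set X → Set X → ENNReal) : Measurable (blockSum 𝒬k 𝒬n w) := by
  have := hck.to_subtype
  have := hcn.to_subtype
  exact Measurable.tsum fun Q => Measurable.tsum fun S =>
    measurable_block (hk _ Q.2) (hn _ S.2) _

lemma lintegral_blockSum (hck : 𝒬k.Countable) (hcn : 𝒬n.Countable)
    (hk : ∀ Q ∈ 𝒬k, MeasurableSet Q) (hn : ∀ Q ∈ 𝒬n, MeasurableSet Q)
    (w : Set X → Set X → ENNReal) (ν : Measure X) [IsFiniteMeasure ν] :
    ∫⁻ p, blockSum 𝒬k 𝒬n w p ∂(ν.prod ν) =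
      ∑' Q : 𝒬k, ∑' S : 𝒬n, w Q S * (ν (Q : Set X) * ν (S : Set X)) := by
  have := hck.to_subtype
  have := hcn.to_subtype
  have hm : ∀ (Q : 𝒬k) (S : 𝒬n), Measurable fun p : X × X =>
      if p.1 ∈ (Q : Set X) ∧ p.2 ∈ (S : Set X) then w Q S else 0 := fun Q S =>
    measurable_block (hk _ Q.2) (hn _ S.2) _
  simp only [blockSum]
  rw [lintegral_tsum fun Q => (Measurable.tsum fun S => hm Q S).aemeasurable]
  refine tsum_congr fun Q => ?_
  rw [lintegral_tsum fun S => (hm Q S).aemeasurable]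
  refine tsum_congr fun S => ?_
  rw [← Measure.prod_prod, ← lintegral_indicator_const ((hk _ Q.2).prod (hn _ S.2))]
  refine lintegral_congr fun p => ?_
  simp [indicator, mem_prod]

end BlockSum

section CondCk

variable {X Ω : Type*} [MeasurableSpace X] [MeasurableSpace Ω] {P : Measure Ω}
  {B : Ω → Set X} {𝒬k 𝒬n : Set (Set X)}

lemma condCk_eq_condCk_restrict (ν : Measure X) (hk : ∀ Q ∈ 𝒬k, MeasurableSet Q) (A : Set X) :
    condCk P B 𝒬k ν A = condCk P B 𝒬k (ν.restrict A) univ := by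
  ext ω
  refine tsum_congr fun Q => ?_
  rw [inter_univ, Measure.restrict_apply (hk _ Q.2)]

lemma measurable_condCk (hck : 𝒬k.Countable)
    (hhk : ∀ Q ∈ 𝒬k, MeasurableSet {ω | (B ω ∩ Q).Nonempty}) (ν : Measure X) (A : Set X) :
    Measurable (condCk P B 𝒬k ν A) := by
  have := hck.to_subtype
  exact Measurable.tsum fun Q =>
    (Measurable.ite (hhk _ Q.2) measurable_const measurable_const).const_mul _

lemma lintegral_condCk_univ [IsFiniteMeasure P] (hck : 𝒬k.Countable)
    (hk : ∀ Q ∈ 𝒬k, MeasurableSet Q)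
    (hdk : ∀ Q ∈ 𝒬k, ∀ S ∈ 𝒬k, Q ≠ S → Q ∩ S = ∅)
    (hhk : ∀ Q ∈ 𝒬k, MeasurableSet {ω | (B ω ∩ Q).Nonempty})
    (hpk : ∀ Q ∈ 𝒬k, 0 < P {ω | (B ω ∩ Q).Nonempty})
    (ν : Measure X) (hν : ν (⋃ Q ∈ 𝒬k, Q)ᶜ = 0) :
    ∫⁻ ω, condCk P B 𝒬k ν univ ω ∂P = ν univ := by
  have := hck.to_subtype
  have hm : ∀ Q : 𝒬k, Measurable fun ω =>
      (if (B ω ∩ (Q : Set X)).Nonempty then ν ((Q : Set X) ∩ univ) else 0) := fun Q =>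
    Measurable.ite (hhk _ Q.2) measurable_const measurable_const
  simp only [condCk]
  rw [lintegral_tsum fun Q => ((hm Q).const_mul _).aemeasurable]
  calc _ = ∑' Q : 𝒬k, ν (Q : Set X) := by
        refine tsum_congr fun Q => ?_
        rw [lintegral_const_mul _ (hm Q)]
        have : ∫⁻ ω, (if (B ω ∩ (Q : Set X)).Nonempty then ν ((Q : Set X) ∩ univ) else 0) ∂P =
            ν Q * P {ω | (B ω ∩ (Q : Set X)).Nonempty} := by
          rw [← lintegral_indicator_const (hhk _ Q.2), inter_univ]
          rfl
        rw [this, mul_comm (ν _), ← mul_assoc,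
          ENNReal.inv_mul_cancel (hpk _ Q.2).ne' (measure_ne_top _ _), one_mul]
    _ = ν (⋃ Q ∈ 𝒬k, Q) := by
        rw [biUnion_eq_iUnion, measure_iUnion _ fun Q => hk _ Q.2]
        exact fun Q S hne => disjoint_iff_inter_eq_empty.2
          (hdk _ Q.2 _ S.2 fun e => hne (Subtype.ext e))
    _ = ν univ := by
        rw [← measure_add_measure_compl (MeasurableSet.biUnion hck hk), hν, add_zero]

lemma lintegral_condCk_mul_condCk (hck : 𝒬k.Countable) (hcn : 𝒬n.Countable)
    (hk : ∀ Q ∈ 𝒬k, MeasurableSet Q) (hn : ∀ Q ∈ 𝒬n, MeasurableSet Q)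
    (hhk : ∀ Q ∈ 𝒬k, MeasurableSet {ω | (B ω ∩ Q).Nonempty})
    (hhn : ∀ Q ∈ 𝒬n, MeasurableSet {ω | (B ω ∩ Q).Nonempty})
    [IsFiniteMeasure P]
    (ν : Measure X) [IsFiniteMeasure ν] :
    ∫⁻ ω, condCk P B 𝒬k ν univ ω * condCk P B 𝒬n ν univ ω ∂P =
      ∫⁻ p, condF P B 𝒬k 𝒬n p.1 p.2 ∂(ν.prod ν) := by
  have := hck.to_subtype
  have := hcn.to_subtype
  simp only [condF_eq_blockSum]
  rw [lintegral_blockSum hck hcn hk hn]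
  have hE : ∀ (Q : 𝒬k) (S : 𝒬n),
      MeasurableSet {ω | (B ω ∩ (Q : Set X)).Nonempty ∧ (B ω ∩ (S : Set X)).Nonempty} :=
    fun Q S => (hhk _ Q.2).inter (hhn _ S.2)
  have hmul : ∀ ω, condCk P B 𝒬k ν univ ω * condCk P B 𝒬n ν univ ω =
      ∑' Q : 𝒬k, ∑' S : 𝒬n,
        {ω | (B ω ∩ (Q : Set X)).Nonempty ∧ (B ω ∩ (S : Set X)).Nonempty}.indicator
        (fun _ => (P {ω' | (B ω' ∩ (Q : Set X)).Nonempty})⁻¹ *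
          (P {ω' | (B ω' ∩ (S : Set X)).Nonempty})⁻¹ * (ν (Q : Set X) * ν (S : Set X))) ω := by
    intro ω
    rw [condCk, condCk, ← ENNReal.tsum_mul_right]
    refine tsum_congr fun Q => ?_
    rw [← ENNReal.tsum_mul_left]
    refine tsum_congr fun S => ?_
    simp only [indicator, mem_ofPred_eq, inter_univ]
    by_cases h1 : (B ω ∩ (Q : Set X)).Nonempty <;> by_cases h2 : (B ω ∩ (S : Set X)).Nonempty <;>
      simp only [h1, h2, if_true, if_false, and_true, and_false, mul_zero, zero_mul]
    ring
  simp only [hmul]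
  rw [lintegral_tsum fun Q => (Measurable.tsum fun S =>
    measurable_const.indicator (hE Q S)).aemeasurable]
  refine tsum_congr fun Q => ?_
  rw [lintegral_tsum fun S => (measurable_const.indicator (hE Q S)).aemeasurable]
  refine tsum_congr fun S => ?_
  rw [lintegral_indicator_const (hE Q S), hitCorr, div_eq_mul_inv,
    ENNReal.mul_inv (Or.inr (measure_ne_top _ _)) (Or.inl (measure_ne_top _ _))]
  ring

end CondCk

section Energy

variable {X : Type*} [MetricSpace X]

/-- Bounding the capacity below by the energy of the normalized restriction of `ν`. -/
lemma sq_mul_inv_le_energy [MeasurableSpace X] {φ : ℝ → ENNReal} {Q : Set X} (hQ : MeasurableSet Q)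
    (ν : Measure X) [IsFiniteMeasure ν] {a : NNReal} (ha : 0 < a) {p : ENNReal}
    (hcap : (a : ENNReal) * phiCapacity φ Q ≤ p) :
    ν Q * ν Q * p⁻¹ ≤ (a : ENNReal)⁻¹ * phiEnergy φ (ν.restrict Q) := by
  rcases eq_or_ne (ν Q) 0 with h0 | h0
  · simp [h0]
  have ht : ν Q ≠ ⊤ := measure_ne_top _ _
  have ha0 : (a : ENNReal) ≠ 0 := by exact_mod_cast ha.ne'
  set τ : Measure X := (ν Q)⁻¹ • ν.restrict Q with hτ
  have hτp : IsProbabilityMeasure τ := ⟨by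
    simp [hτ, ENNReal.inv_mul_cancel h0 ht]⟩
  have hτc : τ Qᶜ = 0 := by
    simp [hτ, Measure.restrict_apply hQ.compl]
  have hτE : phiEnergy φ τ = (ν Q)⁻¹ * ((ν Q)⁻¹ * phiEnergy φ (ν.restrict Q)) := by
    simp only [phiEnergy, hτ, lintegral_smul_measure, smul_eq_mul]
    rw [lintegral_const_mul' _ _ (ENNReal.inv_ne_top.2 h0)]
  have h1 : (phiEnergy φ τ)⁻¹ ≤ phiCapacity φ Q :=
    le_iSup_of_le τ (le_iSup_of_le hτp (le_iSup_of_le hτc le_rfl))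
  have h2 : (a : ENNReal) * (phiEnergy φ τ)⁻¹ ≤ p := le_trans (by gcongr) hcap
  have h3 : p⁻¹ ≤ (a : ENNReal)⁻¹ * phiEnergy φ τ := by
    have := ENNReal.inv_le_inv.2 h2
    rwa [ENNReal.mul_inv (Or.inl ha0) (Or.inl ENNReal.coe_ne_top), inv_inv] at this
  calc ν Q * ν Q * p⁻¹ ≤ ν Q * ν Q * ((a : ENNReal)⁻¹ * phiEnergy φ τ) := by gcongr
    _ = (ν Q * (ν Q)⁻¹) * (ν Q * (ν Q)⁻¹) *
        ((a : ENNReal)⁻¹ * phiEnergy φ (ν.restrict Q)) := by rw [hτE]; ring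
    _ = _ := by rw [ENNReal.mul_inv_cancel h0 ht, one_mul, one_mul]

lemma setEDist_comm (Q S : Set X) : setEDist Q S = setEDist S Q := by
  simp only [setEDist]
  rw [iInf₂_comm]
  simp only [edist_comm]

lemma setEDist_le_edist {Q S : Set X} {x y : X} (hx : x ∈ Q) (hy : y ∈ S) :
    setEDist Q S ≤ edist x y :=
  iInf₂_le_of_le x hx (iInf₂_le_of_le y hy le_rfl)

lemma edist_le_setEDist_add {Q S : Set X} {x y : X} (hx : x ∈ Q) (hy : y ∈ S) :
    edist x y ≤ setEDist Q S + (Metric.ediam Q + Metric.ediam S) := by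
  rw [← tsub_le_iff_right]
  refine le_iInf₂ fun x' hx' => le_iInf₂ fun y' hy' => ?_
  rw [tsub_le_iff_right]
  calc edist x y ≤ edist x x' + edist x' y' + edist y' y := edist_triangle4 _ _ _ _
    _ ≤ Metric.ediam Q + edist x' y' + Metric.ediam S := by
      gcongr
      · exact Metric.edist_le_ediam_of_mem hx hx'
      · exact Metric.edist_le_ediam_of_mem hy' hy
    _ = _ := by ring

/-- For well-separated sets the kernel at the distance of the sets is controlled by the kernel
at the distance of any of their points. -/
lemma kernel_setEDist_le {φ : ℝ → ENNReal} (hφanti : AntitoneOn φ (Set.Ici (0 : ℝ)))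
    {δ : ℝ} (hδ0 : 0 < δ) {c₂ c₃ : NNReal}
    (hker : ∀ r : ℝ, 0 < r → φ r ≤ (c₂ : ENNReal) * φ (r * (1 + 2 * δ)) + (c₃ : ENNReal))
    {Q S : Set X} {x y : X} (hx : x ∈ Q) (hy : y ∈ S)
    (hfar : max (Metric.ediam Q) (Metric.ediam S) < ENNReal.ofReal δ * setEDist Q S) :
    φ (setEDist Q S).toReal ≤ c₂ * φ (dist x y) + c₃ := by
  have htop : setEDist Q S ≠ ⊤ := ne_top_of_le_ne_top (edist_ne_top x y) (setEDist_le_edist hx hy)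
  have hne : setEDist Q S ≠ 0 := by
    intro h
    simp [h] at hfar
  have hpos : 0 < (setEDist Q S).toReal := ENNReal.toReal_pos hne htop
  refine (hker _ hpos).trans ?_
  gcongr
  refine hφanti dist_nonneg (mem_Ici.2 (by positivity)) ?_
  have h1 : edist x y ≤ setEDist Q S + (ENNReal.ofReal δ * setEDist Q S +
      ENNReal.ofReal δ * setEDist Q S) := by
    refine (edist_le_setEDist_add hx hy).trans ?_
    gcongr
    · exact (le_max_left _ _).trans hfar.le
    · exact (le_max_right _ _).trans hfar.le
  rw [← ENNReal.ofReal_toReal htop, ← ENNReal.ofReal_mul hδ0.le, edist_dist,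
    ← ENNReal.ofReal_add (by positivity) (by positivity),
    ← ENNReal.ofReal_add (by positivity) (by positivity),
    ENNReal.ofReal_le_ofReal_iff (by positivity)] at h1
  linarith

end Energy

section NearBlocks

variable {X : Type*} {𝒬 : Set (Set X)}

lemma tsum_ite_le_encard (R : Set X → Prop) [DecidablePred R] {N : ℕ}
    (hN : {S | S ∈ 𝒬 ∧ R S}.encard ≤ (N : ℕ∞)) (b : ENNReal) :
    ∑' S : 𝒬, (if R S then b else 0) ≤ N * b := by
  rw [tsum_subtype 𝒬 fun S => if R S then b else 0]
  calc ∑' S, 𝒬.indicator (fun S => if R S then b else 0) S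
      = ∑' S, {S | S ∈ 𝒬 ∧ R S}.indicator (fun _ => b) S := by
        refine tsum_congr fun S => ?_
        by_cases h1 : S ∈ 𝒬 <;> by_cases h2 : R S <;> simp [h1, h2]
    _ = {S | S ∈ 𝒬 ∧ R S}.encard * b := by
        rw [← tsum_subtype, ENNReal.tsum_set_const]
    _ ≤ N * b := by
        gcongr
        exact_mod_cast hN

lemma tsum_tsum_ite_le (R : Set X → Set X → Prop) [DecidableRel R] (hR : ∀ Q S, R Q S → R S Q) {N : ℕ}
    (hN : ∀ Q ∈ 𝒬, {S | S ∈ 𝒬 ∧ R Q S}.encard ≤ (N : ℕ∞)) (b : Set X → ENNReal)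
    {v : Set X → Set X → ENNReal} (hv : ∀ Q ∈ 𝒬, ∀ S ∈ 𝒬, v Q S ≤ b Q + b S) :
    ∑' Q : 𝒬, ∑' S : 𝒬, (if R Q S then v Q S else 0) ≤ 2 * N * ∑' Q : 𝒬, b Q := by
  have h1 : ∑' Q : 𝒬, ∑' S : 𝒬, (if R Q S then b Q else 0) ≤ N * ∑' Q : 𝒬, b Q := by
    rw [← ENNReal.tsum_mul_left]
    exact ENNReal.tsum_le_tsum fun Q => tsum_ite_le_encard (R Q) (hN _ Q.2) _
  have h2 : ∑' Q : 𝒬, ∑' S : 𝒬, (if R Q S then b S else 0) ≤ N * ∑' Q : 𝒬, b Q := by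
    rw [ENNReal.tsum_comm]
    refine le_trans (le_of_eq ?_) h1
    refine tsum_congr fun Q => tsum_congr fun S => ?_
    have : R (S : Set X) Q ↔ R Q S := ⟨hR _ _, hR _ _⟩
    simp only [this]
  calc _ ≤ ∑' Q : 𝒬, ∑' S : 𝒬, ((if R Q S then b Q else 0) + (if R Q S then b S else 0)) := by
        refine ENNReal.tsum_le_tsum fun Q => ENNReal.tsum_le_tsum fun S => ?_
        split_ifs
        · exact hv _ Q.2 _ S.2
        · simp
    _ ≤ N * ∑' Q : 𝒬, b Q + N * ∑' Q : 𝒬, b Q := by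
        simp only [ENNReal.tsum_add]
        gcongr
    _ = _ := by ring

end NearBlocks

lemma hitCorr_mul_le {X Ω : Type*} [MeasurableSpace Ω] {P : Measure Ω} [IsFiniteMeasure P]
    {B : Ω → Set X} {Q S : Set X} {u v bQ bS : ENNReal}
    (hQ0 : P {ω | (B ω ∩ Q).Nonempty} ≠ 0) (hS0 : P {ω | (B ω ∩ S).Nonempty} ≠ 0)
    (hQ : u * u * (P {ω | (B ω ∩ Q).Nonempty})⁻¹ ≤ bQ)
    (hS : v * v * (P {ω | (B ω ∩ S).Nonempty})⁻¹ ≤ bS) :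
    hitCorr P B Q S * (u * v) ≤ bQ + bS := by
  have h1 : hitCorr P B Q S ≤ (P {ω | (B ω ∩ Q).Nonempty})⁻¹ := by
    refine ENNReal.div_le_of_le_mul ?_
    rw [← mul_assoc, ENNReal.inv_mul_cancel hQ0 (measure_ne_top _ _), one_mul]
    exact measure_mono fun ω h => h.2
  have h2 : hitCorr P B Q S ≤ (P {ω | (B ω ∩ S).Nonempty})⁻¹ := by
    refine ENNReal.div_le_of_le_mul ?_
    rw [mul_comm (P _), ← mul_assoc, ENNReal.inv_mul_cancel hS0 (measure_ne_top _ _), one_mul]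
    exact measure_mono fun ω h => h.1
  rcases le_total u v with h | h
  · calc hitCorr P B Q S * (u * v) ≤ (P {ω | (B ω ∩ S).Nonempty})⁻¹ * (v * v) := by gcongr
      _ ≤ bS := by rwa [mul_comm]
      _ ≤ _ := le_add_self
  · calc hitCorr P B Q S * (u * v) ≤ (P {ω | (B ω ∩ Q).Nonempty})⁻¹ * (u * u) := by gcongr
      _ ≤ bQ := by rwa [mul_comm]
      _ ≤ _ := le_self_add

lemma tsum_phiEnergy_restrict_eq {X : Type*} [MetricSpace X] [MeasurableSpace X]
    {𝒬 : Set (Set X)} (hcount : 𝒬.Countable) (hQmeas : ∀ Q ∈ 𝒬, MeasurableSet Q)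
    (hQdisj : ∀ Q ∈ 𝒬, ∀ S ∈ 𝒬, Q ≠ S → Q ∩ S = ∅)
    {φ : ℝ → ENNReal} (hφm : Measurable fun p : X × X => φ (dist p.1 p.2))
    (ν : Measure X) [IsFiniteMeasure ν] :
    ∑' Q : 𝒬, phiEnergy φ (ν.restrict Q) =
      ∫⁻ p in ⋃ Q : 𝒬, (Q : Set X) ×ˢ (Q : Set X), φ (dist p.1 p.2) ∂(ν.prod ν) := by
  have := hcount.to_subtype
  rw [lintegral_iUnion (fun Q : 𝒬 => (hQmeas _ Q.2).prod (hQmeas _ Q.2))]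
  · refine tsum_congr fun Q => ?_
    rw [← Measure.prod_restrict, lintegral_prod _ hφm.aemeasurable, phiEnergy]
  · intro Q S hne
    refine Disjoint.set_prod_left (disjoint_iff_inter_eq_empty.2 ?_) _ _
    exact hQdisj _ Q.2 _ S.2 fun e => hne (Subtype.ext e)

lemma tsum_phiEnergy_restrict_le {X : Type*} [MetricSpace X] [MeasurableSpace X]
    {𝒬 : Set (Set X)} (hcount : 𝒬.Countable) (hQmeas : ∀ Q ∈ 𝒬, MeasurableSet Q)
    (hQdisj : ∀ Q ∈ 𝒬, ∀ S ∈ 𝒬, Q ≠ S → Q ∩ S = ∅)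
    {φ : ℝ → ENNReal} (hφm : Measurable fun p : X × X => φ (dist p.1 p.2))
    (ν : Measure X) [IsFiniteMeasure ν] :
    ∑' Q : 𝒬, phiEnergy φ (ν.restrict Q) ≤ phiEnergy φ ν := by
  rw [tsum_phiEnergy_restrict_eq hcount hQmeas hQdisj hφm, phiEnergy,
    ← lintegral_prod _ hφm.aemeasurable]
  exact setLIntegral_le_lintegral _ _

/-- The energy of `ν` restricted to the blocks `Q × Q` tends to `0` as the diameters do. -/
lemma tendsto_tsum_phiEnergy_restrict {X : Type*} [MetricSpace X] [MeasurableSpace X]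
    {𝒬 : ℕ → Set (Set X)}
    (hcount : ∀ k, (𝒬 k).Countable) (hQmeas : ∀ k, ∀ Q ∈ 𝒬 k, MeasurableSet Q)
    (hQdisj : ∀ k, ∀ Q ∈ 𝒬 k, ∀ S ∈ 𝒬 k, Q ≠ S → Q ∩ S = ∅)
    (hdiam : Tendsto (fun k : ℕ => ⨆ Q ∈ 𝒬 k, Metric.ediam Q) atTop (𝓝 0))
    {φ : ℝ → ENNReal} (hφm : Measurable fun p : X × X => φ (dist p.1 p.2)) (hφ0 : φ 0 = ⊤)
    (ν : Measure X) [IsFiniteMeasure ν] (henergy : phiEnergy φ ν < ⊤) :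
    Tendsto (fun k => ∑' Q : 𝒬 k, phiEnergy φ (ν.restrict Q)) atTop (𝓝 0) := by
  have hE : ∫⁻ p, φ (dist p.1 p.2) ∂(ν.prod ν) < ⊤ := by
    rwa [lintegral_prod _ hφm.aemeasurable]
  have hU : ∀ k, MeasurableSet (⋃ Q : 𝒬 k, (Q : Set X) ×ˢ (Q : Set X)) := fun k => by
    have := (hcount k).to_subtype
    exact MeasurableSet.iUnion fun Q => (hQmeas k _ Q.2).prod (hQmeas k _ Q.2)
  simp only [fun k => tsum_phiEnergy_restrict_eq (hcount k) (hQmeas k) (hQdisj k) hφm ν,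
    ← lintegral_indicator (hU _)]
  have hae : ∀ᵐ p ∂(ν.prod ν), p.1 ≠ p.2 := by
    filter_upwards [ae_lt_top hφm hE.ne] with p hp h
    rw [h, dist_self, hφ0] at hp
    exact lt_irrefl _ hp
  rw [← lintegral_zero (μ := ν.prod ν)]
  refine tendsto_lintegral_of_dominated_convergence (fun p => φ (dist p.1 p.2))
    (fun k => hφm.indicator (hU k)) (fun k => Eventually.of_forall fun p => indicator_le_self _ _ _)
    hE.ne ?_
  filter_upwards [hae] with p hp
  refine tendsto_const_nhds.congr' ?_
  filter_upwards [hdiam.eventually_lt_const (edist_pos.2 hp)] with k hk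
  refine (indicator_of_notMem ?_ _).symm
  simp only [mem_iUnion, mem_prod, not_exists, not_and]
  intro Q h1 h2
  refine absurd hk (not_lt.2 ?_)
  exact (Metric.edist_le_ediam_of_mem h1 h2).trans (le_iSup₂_of_le (Q : Set X) Q.2 le_rfl)

/-- The second moments `E(𝒞_k(ν)²)` split into a part dominated by the kernel and a part bounded
by the energy close to the diagonal. -/
lemma exists_far_near_bound {X Ω : Type*} [MetricSpace X] [MeasurableSpace X] [MeasurableSpace Ω]
    {P : Measure Ω} [IsFiniteMeasure P] {B : Ω → Set X} {𝒬 : Set (Set X)}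
    (hcount : 𝒬.Countable) (hQmeas : ∀ Q ∈ 𝒬, MeasurableSet Q)
    (hQdisj : ∀ Q ∈ 𝒬, ∀ S ∈ 𝒬, Q ≠ S → Q ∩ S = ∅)
    (hhitpos : ∀ Q ∈ 𝒬, 0 < P {ω | (B ω ∩ Q).Nonempty})
    {φ : ℝ → ENNReal} (hφanti : AntitoneOn φ (Set.Ici (0 : ℝ)))
    {a : NNReal} (ha : 0 < a)
    (hcap : ∀ Q ∈ 𝒬, (a : ENNReal) * phiCapacity φ Q ≤ P {ω | (B ω ∩ Q).Nonempty})
    {δ : ℝ} (hδ0 : 0 < δ) {c₂ c₃ : NNReal}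
    (hker : ∀ r : ℝ, 0 < r → φ r ≤ (c₂ : ENNReal) * φ (r * (1 + 2 * δ)) + (c₃ : ENNReal))
    {c : NNReal}
    (hindep : ∀ Q ∈ 𝒬, ∀ S ∈ 𝒬,
      max (Metric.ediam Q) (Metric.ediam S) < ENNReal.ofReal δ * setEDist Q S →
      P {ω | (B ω ∩ Q).Nonempty ∧ (B ω ∩ S).Nonempty}
        ≤ (c : ENNReal) * P {ω | (B ω ∩ Q).Nonempty} * P {ω | (B ω ∩ S).Nonempty} *
            φ (setEDist Q S).toReal)
    {Mδ : ℕ}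
    (hMδ : ∀ Q ∈ 𝒬, {S | S ∈ 𝒬 ∧
        ENNReal.ofReal δ * setEDist Q S ≤ max (Metric.ediam Q) (Metric.ediam S)}.encard
        ≤ (Mδ : ℕ∞))
    (ν : Measure X) [IsFiniteMeasure ν] :
    ∃ f : X × X → ENNReal, Measurable f ∧ (∀ p, f p ≤ condF P B 𝒬 𝒬 p.1 p.2) ∧
      (∀ p, f p ≤ c * (c₂ * φ (dist p.1 p.2) + c₃)) ∧
      ∫⁻ p, condF P B 𝒬 𝒬 p.1 p.2 ∂(ν.prod ν) ≤ ∫⁻ p, f p ∂(ν.prod ν) +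
        2 * Mδ * (a : ENNReal)⁻¹ * ∑' Q : 𝒬, phiEnergy φ (ν.restrict Q) := by
  set R : Set X → Set X → Prop := fun Q S =>
    ENNReal.ofReal δ * setEDist Q S ≤ max (Metric.ediam Q) (Metric.ediam S) with hR
  refine ⟨blockSum 𝒬 𝒬 fun Q S => if R Q S then 0 else hitCorr P B Q S,
    measurable_blockSum hcount hcount hQmeas hQmeas _, fun p => ?_, fun p => ?_, ?_⟩
  · rw [condF_eq_blockSum]
    refine blockSum_mono (fun Q S => ?_) _
    split_ifs
    · exact zero_le
    · exact le_rfl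
  · refine blockSum_le hQdisj hQdisj fun Q hQ S hS hx hy => ?_
    split_ifs with h
    · exact zero_le
    have hfar := not_le.1 h
    refine ENNReal.div_le_of_le_mul ((hindep Q hQ S hS hfar).trans ?_)
    calc _ ≤ (c : ENNReal) * P {ω | (B ω ∩ Q).Nonempty} * P {ω | (B ω ∩ S).Nonempty} *
            (c₂ * φ (dist p.1 p.2) + c₃) := by
          gcongr
          exact kernel_setEDist_le hφanti hδ0 hker hx hy hfar
      _ = _ := by ring
  · have hsplit : ∀ p : X × X, condF P B 𝒬 𝒬 p.1 p.2 =
        blockSum 𝒬 𝒬 (fun Q S => if R Q S then 0 else hitCorr P B Q S) p +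
        blockSum 𝒬 𝒬 (fun Q S => if R Q S then hitCorr P B Q S else 0) p := fun p => by
      rw [condF_eq_blockSum, ← blockSum_add]
      congr 1
      ext Q S
      split_ifs <;> simp
    simp only [hsplit]
    rw [lintegral_add_left (measurable_blockSum hcount hcount hQmeas hQmeas _)]
    gcongr
    rw [lintegral_blockSum hcount hcount hQmeas hQmeas, mul_assoc, ← ENNReal.tsum_mul_left]
    simp only [ite_mul, zero_mul]
    refine tsum_tsum_ite_le R (v := fun Q S => hitCorr P B Q S * (ν Q * ν S))
      (fun Q S h => ?_) hMδ
      (fun Q => (a : ENNReal)⁻¹ * phiEnergy φ (ν.restrict Q)) fun Q hQ S hS => ?_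
    · simpa only [hR, setEDist_comm S Q, max_comm (Metric.ediam S)] using h
    · exact hitCorr_mul_le (hhitpos Q hQ).ne' (hhitpos S hS).ne'
        (sq_mul_inv_le_energy (hQmeas Q hQ) ν ha (hcap Q hQ))
        (sq_mul_inv_le_energy (hQmeas S hS) ν ha (hcap S hS))

/-- If the integrals of `F k k` are, up to a null sequence, integrals of minorants with a common
integrable bound, and the lower and upper double limits of `F` agree, then the diagonal integrals
are asymptotically at most, and the double-indexed ones at least, the same finite limit. -/
lemma exists_lim_of_dominated_diagonal {α : Type*} [MeasurableSpace α] {μ : Measure α}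
    {F : ℕ → ℕ → α → ENNReal} (hFm : ∀ k n, Measurable (F k n)) {f : ℕ → α → ENNReal}
    (hfm : ∀ k, Measurable (f k)) (hfF : ∀ k p, f k p ≤ F k k p) {g : α → ENNReal}
    (hfg : ∀ k p, f k p ≤ g p) (hg : ∫⁻ p, g p ∂μ ≠ ⊤) {r : ℕ → ENNReal}
    (hr : Tendsto r atTop (𝓝 0)) (hle : ∀ k, ∫⁻ p, F k k p ∂μ ≤ ∫⁻ p, f k p ∂μ + r k)
    (hlim : ∀ᵐ p ∂μ, (⨆ N : ℕ, ⨅ k : ℕ, ⨅ (_ : N ≤ k), ⨅ n : ℕ, ⨅ (_ : N ≤ n), F k n p) =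
      ⨅ N : ℕ, ⨆ k : ℕ, ⨆ (_ : N ≤ k), ⨆ n : ℕ, ⨆ (_ : N ≤ n), F k n p) :
    ∃ L : ENNReal, L ≠ ⊤ ∧ ∀ ε > 0, ∃ N, ∀ k ≥ N,
      ∫⁻ p, F k k p ∂μ ≤ L + ε ∧ ∀ n ≥ N, L ≤ ∫⁻ p, F k n p ∂μ + ε := by
  set l : ℕ → α → ENNReal :=
    fun N p => ⨅ k : ℕ, ⨅ (_ : N ≤ k), ⨅ n : ℕ, ⨅ (_ : N ≤ n), F k n p with hl
  have hlm : ∀ N, Measurable (l N) := fun N =>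
    Measurable.iInf fun k => Measurable.iInf fun _ => Measurable.iInf fun n =>
      Measurable.iInf fun _ => hFm k n
  have hmono : Monotone l := fun N N' h p =>
    le_iInf₂ fun k hk => le_iInf₂ fun n hn =>
      iInf₂_le_of_le k (h.trans hk) (iInf₂_le_of_le n (h.trans hn) le_rfl)
  have hl_le : ∀ N k n, N ≤ k → N ≤ n → ∀ p, l N p ≤ F k n p := fun N k n hk hn p =>
    iInf₂_le_of_le k hk (iInf₂_le_of_le n hn le_rfl)
  have hsup : ∫⁻ p, ⨆ N, l N p ∂μ = ⨆ N, ∫⁻ p, l N p ∂μ := lintegral_iSup hlm hmono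
  have hLfin : ∫⁻ p, ⨆ N, l N p ∂μ ≠ ⊤ := by
    obtain ⟨K, hK⟩ := eventually_atTop.1 (hr.eventually_lt_const zero_lt_one)
    refine ne_top_of_le_ne_top (ENNReal.add_ne_top.2 ⟨hg, ENNReal.one_ne_top⟩) ?_
    rw [hsup]
    refine iSup_le fun N => ?_
    calc ∫⁻ p, l N p ∂μ ≤ ∫⁻ p, F (max N K) (max N K) p ∂μ :=
          lintegral_mono (hl_le N _ _ (le_max_left _ _) (le_max_left _ _))
      _ ≤ ∫⁻ p, f (max N K) p ∂μ + r (max N K) := hle _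
      _ ≤ ∫⁻ p, g p ∂μ + 1 :=
          add_le_add (lintegral_mono (hfg _)) (hK _ (le_max_right _ _)).le
  refine ⟨_, hLfin, fun ε hε => ?_⟩
  have hlimsup : limsup (fun k => ∫⁻ p, f k p ∂μ) atTop ≤ ∫⁻ p, ⨆ N, l N p ∂μ := by
    refine (limsup_lintegral_le g hfm (fun k => Eventually.of_forall (hfg k)) hg).trans ?_
    refine lintegral_mono_ae ?_
    filter_upwards [hlim] with p hp
    rw [hp, limsup_eq_iInf_iSup_of_nat]
    refine iInf_mono fun N => iSup₂_le fun k hk => ?_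
    exact (hfF k p).trans (le_iSup₂_of_le k hk (le_iSup₂_of_le k hk le_rfl))
  have hε2 : ε / 2 ≠ 0 := (ENNReal.half_pos hε.ne').ne'
  have h1 := eventually_lt_of_limsup_lt
    (hlimsup.trans_lt (ENNReal.lt_add_right hLfin hε2))
  have h2 := hr.eventually_lt_const (pos_iff_ne_zero.2 hε2)
  have h3 : ∃ N, ∫⁻ p, ⨆ N, l N p ∂μ ≤ ∫⁻ p, l N p ∂μ + ε := by
    rcases eq_or_ne (∫⁻ p, ⨆ N, l N p ∂μ) 0 with h0 | h0
    · exact ⟨0, by simp [h0]⟩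
    have := ENNReal.sub_lt_self hLfin h0 hε.ne'
    nth_rewrite 2 [hsup] at this
    obtain ⟨N, hN⟩ := lt_iSup_iff.1 this
    exact ⟨N, tsub_le_iff_right.1 hN.le⟩
  obtain ⟨N₁, hN₁⟩ := eventually_atTop.1 (h1.and h2)
  obtain ⟨N₂, hN₂⟩ := h3
  refine ⟨max N₁ N₂, fun k hk => ⟨?_, fun n hn => ?_⟩⟩
  · obtain ⟨h4, h5⟩ := hN₁ k ((le_max_left _ _).trans hk)
    calc ∫⁻ p, F k k p ∂μ ≤ ∫⁻ p, f k p ∂μ + r k := hle k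
      _ ≤ (∫⁻ p, ⨆ N, l N p ∂μ + ε / 2) + ε / 2 := add_le_add h4.le h5.le
      _ = _ := by rw [add_assoc, ENNReal.add_halves]
  · refine hN₂.trans ?_
    gcongr
    exact hl_le _ _ _ ((le_max_right _ _).trans hk) ((le_max_right _ _).trans hn) _

/-- Second moments and mixed moments with a common limit give an `L²`-Cauchy sequence. -/
lemma tendsto_lintegral_tsub_add_tsub_sq {Ω : Type*} [MeasurableSpace Ω] {P : Measure Ω}
    {C : ℕ → Ω → ENNReal} (hC : ∀ k, Measurable (C k)) {L : ENNReal} (hL : L ≠ ⊤)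
    (h : ∀ ε > 0, ∃ N, ∀ k ≥ N, ∫⁻ ω, C k ω * C k ω ∂P ≤ L + ε ∧
      ∀ n ≥ N, L ≤ ∫⁻ ω, C k ω * C n ω ∂P + ε) :
    Tendsto (fun p : ℕ × ℕ =>
      ∫⁻ ω, ((C p.1 ω - C p.2 ω) + (C p.2 ω - C p.1 ω)) ^ 2 ∂P) atTop (𝓝 0) := by
  rw [ENNReal.tendsto_nhds_zero]
  intro ε hε
  obtain ⟨N, hN⟩ := h (ε / 4) (ENNReal.div_pos hε.ne' (by norm_num))
  filter_upwards [eventually_ge_atTop (N, N)] with ⟨k, n⟩ hkn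
  obtain ⟨hk, hn⟩ : N ≤ k ∧ N ≤ n := hkn
  have hgm : Measurable fun ω => ((C k ω - C n ω) + (C n ω - C k ω)) ^ 2 :=
    (((hC k).sub (hC n)).add ((hC n).sub (hC k))).pow_const 2
  have h1 : ∫⁻ ω, ((C k ω - C n ω) + (C n ω - C k ω)) ^ 2 ∂P + 2 * ∫⁻ ω, C k ω * C n ω ∂P ≤
      ∫⁻ ω, C k ω * C k ω ∂P + ∫⁻ ω, C n ω * C n ω ∂P := by
    have hmm : ∀ i j, Measurable fun ω => C i ω * C j ω := fun i j => (hC i).mul (hC j)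
    rw [← lintegral_const_mul _ (hmm k n), ← lintegral_add_left hgm,
      ← lintegral_add_left (hmm k k)]
    refine lintegral_mono fun ω => ?_
    simpa only [sq] using tsub_add_tsub_sq_add_le (C k ω) (C n ω)
  have h2 : ∫⁻ ω, ((C k ω - C n ω) + (C n ω - C k ω)) ^ 2 ∂P + 2 * L ≤ ε + 2 * L := by
    calc _ ≤ ∫⁻ ω, ((C k ω - C n ω) + (C n ω - C k ω)) ^ 2 ∂P +
          2 * (∫⁻ ω, C k ω * C n ω ∂P + ε / 4) := by
          gcongr
          exact (hN k hk).2 n hn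
      _ = (∫⁻ ω, ((C k ω - C n ω) + (C n ω - C k ω)) ^ 2 ∂P +
          2 * ∫⁻ ω, C k ω * C n ω ∂P) + 2 * (ε / 4) := by ring
      _ ≤ (L + ε / 4) + (L + ε / 4) + 2 * (ε / 4) := by
          gcongr ?_ + _
          exact h1.trans (add_le_add (hN k hk).1 (hN n hn).1)
      _ = 4 * (ε / 4) + 2 * L := by ring
      _ = ε + 2 * L := by
          rw [ENNReal.mul_div_cancel (by norm_num) (by norm_num)]
  exact (ENNReal.add_le_add_iff_right (ENNReal.mul_ne_top (by norm_num) hL)).1 h2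

/-- **`L²` convergence of the approximating conditional measures.**  Under the standing
assumptions on `φ`, the nested families `𝒬_k` of vanishing diameter and comparable sizes,
and the random set `B`, if `ν` is a finite Borel measure carried by
`X₀ = ⋂_k ⋃_{Q∈𝒬_k} Q` with finite `φ`-energy and `F̲ = F̄` holds `ν×ν`-a.e., then for
every Borel set `A` the sequence `𝒞_k(ν)(A)` converges in `L²` (hence in `L¹` and in
probability) to a square-integrable limit `μ(A)` with `E(μ(A)) = ν(A)`. -/
theorem condCk_tendsto_L2
    {X : Type*} [MetricSpace X] [CompleteSpace X] [TopologicalSpace.SeparableSpace X]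
    [MeasurableSpace X] [BorelSpace X]
    {Ω : Type*} [MeasurableSpace Ω] (P : Measure Ω) [IsProbabilityMeasure P]
    (B : Ω → Set X) (𝒬 : ℕ → Set (Set X))
    (hcount : ∀ k, (𝒬 k).Countable)
    (hQmeas : ∀ k, ∀ Q ∈ 𝒬 k, MeasurableSet Q)
    (hQdisj : ∀ k, ∀ Q ∈ 𝒬 k, ∀ S ∈ 𝒬 k, Q ≠ S → Q ∩ S = ∅)
    (hhitmeas : ∀ k, ∀ Q ∈ 𝒬 k, MeasurableSet {ω | (B ω ∩ Q).Nonempty})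
    (hhitpos : ∀ k, ∀ Q ∈ 𝒬 k, 0 < P {ω | (B ω ∩ Q).Nonempty})
    (hdiam : Tendsto (fun k : ℕ => ⨆ Q ∈ 𝒬 k, EMetric.diam Q) atTop (𝓝 0))
    (hnest : ∀ k : ℕ, 1 ≤ k → ∀ Q ∈ 𝒬 k, ∃! D : Set X, D ∈ 𝒬 (k - 1) ∧ Q ⊆ D)
    (φ : ℝ → ENNReal)
    (hφcont : ContinuousOn φ (Set.Ici (0 : ℝ)))
    (hφanti : AntitoneOn φ (Set.Ici (0 : ℝ)))
    (hφfin : ∀ r : ℝ, 0 < r → φ r ≠ ⊤)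
    (hφ0 : φ 0 = ⊤)
    (M : NNReal) (hM : 0 < M)
    (hsize : ∀ k, ∀ Q ∈ 𝒬 k, ∀ S ∈ 𝒬 k,
      0 < EMetric.diam Q ∧ EMetric.diam Q < ⊤ ∧
      EMetric.diam Q / (M : ENNReal) ≤ EMetric.diam S ∧
      EMetric.diam S ≤ EMetric.diam Q * (M : ENNReal))
    (a : NNReal) (ha : 0 < a)
    (hcap : ∀ k, ∀ Q ∈ 𝒬 k,
      (a : ENNReal) * phiCapacity φ Q ≤ P {ω | (B ω ∩ Q).Nonempty})
    (δ : ℝ) (hδ0 : 0 < δ) (hδ1 : δ < 1)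
    (c₂ c₃ : NNReal)
    (hker : ∀ r : ℝ, 0 < r → φ r ≤ (c₂ : ENNReal) * φ (r * (1 + 2 * δ)) + (c₃ : ENNReal))
    (c : NNReal)
    (hindep : ∀ k n : ℕ, ∀ Q ∈ 𝒬 k, ∀ S ∈ 𝒬 n,
      max (EMetric.diam Q) (EMetric.diam S) < ENNReal.ofReal δ * setEDist Q S →
      P {ω | (B ω ∩ Q).Nonempty ∧ (B ω ∩ S).Nonempty}
        ≤ (c : ENNReal) * P {ω | (B ω ∩ Q).Nonempty} * P {ω | (B ω ∩ S).Nonempty} *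
            φ (setEDist Q S).toReal)
    (Mδ : ℕ)
    (hMδ : ∀ k, ∀ Q ∈ 𝒬 k,
      {S | S ∈ 𝒬 k ∧
        ENNReal.ofReal δ * setEDist Q S ≤ max (EMetric.diam Q) (EMetric.diam S)}.encard
        ≤ (Mδ : ℕ∞))
    (ν : Measure X) [IsFiniteMeasure ν]
    (hX₀ : ν (⋂ k : ℕ, ⋃ Q ∈ 𝒬 k, Q)ᶜ = 0)
    (henergy : phiEnergy φ ν < ⊤)
    (hF : ∀ᵐ p ∂(ν.prod ν), condFlow P B 𝒬 p.1 p.2 = condFup P B 𝒬 p.1 p.2) :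
    ∀ A : Set X, MeasurableSet A →
      ∃ Y : Ω → ENNReal, Measurable Y ∧
        (∫⁻ ω, Y ω ^ 2 ∂P) < ⊤ ∧
        Tendsto (fun k : ℕ =>
            ∫⁻ ω, ((condCk P B (𝒬 k) ν A ω - Y ω) + (Y ω - condCk P B (𝒬 k) ν A ω)) ^ 2 ∂P)
          atTop (𝓝 0) ∧
        ∫⁻ ω, Y ω ∂P = ν A := by
  have := UniformSpace.secondCountable_of_separable X
  intro A hA
  have hφm : Measurable fun p : X × X => φ (dist p.1 p.2) :=
    (hφcont.comp_continuous continuous_dist fun _ => dist_nonneg).measurable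
  set ν' := ν.restrict A with hν'
  have hle : ν' ≤ ν := Measure.restrict_le_self
  have hE' : phiEnergy φ ν' < ⊤ := lt_of_le_of_lt
    (lintegral_mono' hle fun x => lintegral_mono' hle le_rfl) henergy
  have hF' : ∀ᵐ p ∂(ν'.prod ν'), condFlow P B 𝒬 p.1 p.2 = condFup P B 𝒬 p.1 p.2 := by
    rw [hν', Measure.prod_restrict]
    exact ae_restrict_of_ae hF
  have hX' : ∀ k, ν' (⋃ Q ∈ 𝒬 k, Q)ᶜ = 0 := fun k => by
    refine le_antisymm ((hle _).trans ?_) zero_le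
    rw [← hX₀]
    exact measure_mono (compl_subset_compl.2 (iInter_subset _ k))
  have hCm : ∀ k, Measurable (condCk P B (𝒬 k) ν' univ) := fun k =>
    measurable_condCk (hcount k) (hhitmeas k) _ _
  have hmul : ∀ k n, ∫⁻ ω, condCk P B (𝒬 k) ν' univ ω * condCk P B (𝒬 n) ν' univ ω ∂P =
      ∫⁻ p, condF P B (𝒬 k) (𝒬 n) p.1 p.2 ∂(ν'.prod ν') := fun k n =>
    lintegral_condCk_mul_condCk (hcount k) (hcount n) (hQmeas k) (hQmeas n) (hhitmeas k)
      (hhitmeas n) ν'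
  choose f hfm hfF hfg hf_le using fun k => exists_far_near_bound (hcount k) (hQmeas k) (hQdisj k)
    (hhitpos k) hφanti ha (hcap k) hδ0 hker (hindep k k) (hMδ k) ν'
  have hg : ∫⁻ p : X × X, c * (c₂ * φ (dist p.1 p.2) + c₃) ∂(ν'.prod ν') ≠ ⊤ := by
    rw [lintegral_const_mul' _ _ ENNReal.coe_ne_top, lintegral_add_right _ measurable_const,
      lintegral_const_mul' _ _ ENNReal.coe_ne_top, lintegral_prod _ hφm.aemeasurable,
      lintegral_const]
    exact ENNReal.mul_ne_top ENNReal.coe_ne_top (ENNReal.add_ne_top.2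
      ⟨ENNReal.mul_ne_top ENNReal.coe_ne_top hE'.ne,
        ENNReal.mul_ne_top ENNReal.coe_ne_top (measure_ne_top _ _)⟩)
  have hsum := tendsto_tsum_phiEnergy_restrict hcount hQmeas hQdisj hdiam hφm hφ0 ν' hE'
  have hKtop : 2 * (Mδ : ENNReal) * (a : ENNReal)⁻¹ ≠ ⊤ :=
    ENNReal.mul_ne_top (by finiteness) (ENNReal.inv_ne_top.2 (by exact_mod_cast ha.ne'))
  have hr : Tendsto (fun k => 2 * (Mδ : ENNReal) * (a : ENNReal)⁻¹ *
      ∑' Q : 𝒬 k, phiEnergy φ (ν'.restrict Q)) atTop (𝓝 0) := by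
    simpa using ENNReal.Tendsto.const_mul hsum (Or.inr hKtop)
  obtain ⟨L, hL, hLε⟩ := exists_lim_of_dominated_diagonal
    (F := fun k n (p : X × X) => condF P B (𝒬 k) (𝒬 n) p.1 p.2)
    (fun k n => measurable_blockSum (hcount k) (hcount n) (hQmeas k) (hQmeas n) (hitCorr P B))
    hfm hfF hfg hg hr hf_le hF'
  simp only [← hmul] at hLε
  have hcau := tendsto_lintegral_tsub_add_tsub_sq hCm hL hLε
  simp only [condCk_eq_condCk_restrict ν (hQmeas _) A]
  refine exists_tendsto_L2_of_cauchy P hCm (fun k => ?_) (fun k => ?_) hcau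
  · simp only [sq, hmul]
    refine ne_top_of_le_ne_top (ENNReal.add_ne_top.2 ⟨ne_top_of_le_ne_top hg
      (lintegral_mono (hfg k)), ENNReal.mul_ne_top hKtop ?_⟩) (hf_le k)
    exact ne_top_of_le_ne_top hE'.ne
      (tsum_phiEnergy_restrict_le (hcount k) (hQmeas k) (hQdisj k) hφm ν')
  · rw [← Measure.restrict_apply_univ A]
    exact lintegral_condCk_univ (hcount k) (hQmeas k) (hQdisj k) (hhitmeas k) (hhitpos k) ν' (hX' k)
end
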